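/- Suppose the coefficients depend only on x_1 and are smooth in x_1: A^{αβ}(t,x) = Ā^{αβ}(x_1) with each Ā^{αβ} a C^∞ function of one real variable satisfying the bound and ellipticity conditions with constant δ. Suppose u : ℝ^{1+d} → ℝ^m is smooth and satisfies −u_t + D_α(A^{αβ}D_βu) = 0 weakly in Q_4, and set U = Σ_{β=1}^d Ā^{1β}(x_1) D_βu. Then [U]_{C^{1/2}(Q_1)} ≤ N ‖Du‖_{L_2(Q_4)} and [D_αu]_{C^{1/2}(Q_1)} ≤ N ‖Du‖_{L_2(Q_4)} for every α = 2,…,d, where N = N(d,m,δ) does not depend on any smoothness norms of Ā. -/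

import Mathlib

open MeasureTheory Metric Set Function
open scoped ENNReal NNReal RealInnerProductSpace BigOperators

noncomputable section

/-- `ℝ^d` with the Euclidean norm. -/
abbrev Ed (d : ℕ) : Type := EuclideanSpace ℝ (Fin d)
/-- `ℝ^m` with the Euclidean norm. -/
abbrev Em (m : ℕ) : Type := EuclideanSpace ℝ (Fin m)
/-- `m × m` real matrices, viewed as linear operators on `ℝ^m`. -/
abbrev CLM (m : ℕ) : Type := Em m →L[ℝ] Em m

/-- Spatial partial derivative `D_α u` of a function on `ℝ^{1+d}`. -/
def pd {d : ℕ} {F : Type*} [NormedAddCommGroup F] [NormedSpace ℝ F]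
    (α : Fin d) (u : ℝ × Ed d → F) (q : ℝ × Ed d) : F :=
  fderiv ℝ u q (0, EuclideanSpace.single α 1)

/-- Time derivative `∂_t u` of a function on `ℝ^{1+d}`. -/
def pt {d : ℕ} {F : Type*} [NormedAddCommGroup F] [NormedSpace ℝ F]
    (u : ℝ × Ed d → F) (q : ℝ × Ed d) : F :=
  fderiv ℝ u q (1, 0)

/-- `|Du|²`, the squared Euclidean norm of the spatial gradient. -/
def gradSq {d m : ℕ} (u : ℝ × Ed d → Em m) (q : ℝ × Ed d) : ℝ :=
  ∑ α, ‖pd α u q‖ ^ 2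

/-- The parabolic cylinder `Q_r(t,x) = (t - r², t) × B_r(x)`. -/
def Qc {d : ℕ} (r t : ℝ) (x : Ed d) : Set (ℝ × Ed d) :=
  Ioo (t - r ^ 2) t ×ˢ ball x r

/-- `Q_r = Q_r(0,0)`. -/
def Qc0 {d : ℕ} (r : ℝ) : Set (ℝ × Ed d) := Qc r 0 0

/-- Boundedness by `δ⁻¹` together with the ellipticity condition with constant `δ`
for a family of `m × m` matrices. -/
def EllipticPt (δ : ℝ) {d m : ℕ} (a : Fin d → Fin d → CLM m) : Prop :=
  (∀ α β, ‖a α β‖ ≤ δ⁻¹) ∧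
  ∀ ξ : Fin d → Em m, δ * ∑ α, ‖ξ α‖ ^ 2 ≤ ∑ α, ∑ β, ⟪ξ α, a α β (ξ β)⟫

/-- Measurable, bounded, uniformly elliptic coefficients on `ℝ^{1+d}`. -/
def Coeffs (δ : ℝ) {d m : ℕ} (A : Fin d → Fin d → ℝ × Ed d → CLM m) : Prop :=
  (∀ α β, Measurable (A α β)) ∧ ∀ q, EllipticPt δ (fun α β => A α β q)

/-- The class `𝒜`: measurable, bounded, uniformly elliptic coefficients depending on
one real variable. -/
def CoeffsOne (δ : ℝ) {d m : ℕ} (Ab : Fin d → Fin d → ℝ → CLM m) : Prop :=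
  (∀ α β, Measurable (Ab α β)) ∧ ∀ s, EllipticPt δ (fun α β => Ab α β s)

/-- The class `Ψ` of `C^{1,1}` diffeomorphisms of `ℝ^d`: `ψ` and its inverse `φ`
are `C^1` with Lipschitz first derivatives, and `|Dψ| + |D²ψ| ≤ δ⁻¹`,
`|Dφ| + |D²φ| ≤ δ⁻¹` (where the second derivative is measured by the Lipschitz
constant of the first derivative). -/
def IsPsi (δ : ℝ) {d : ℕ} (ψ φ : Ed d → Ed d) : Prop :=
  Function.LeftInverse φ ψ ∧ Function.RightInverse φ ψ ∧
  ContDiff ℝ 1 ψ ∧ ContDiff ℝ 1 φ ∧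
  ∃ K K' : ℝ≥0, LipschitzWith K (fderiv ℝ ψ) ∧ LipschitzWith K' (fderiv ℝ φ) ∧
    (∀ x, ‖fderiv ℝ ψ x‖ + (K : ℝ) ≤ δ⁻¹) ∧ ∀ y, ‖fderiv ℝ φ y‖ + (K' : ℝ) ≤ δ⁻¹

/-- `U = Σ_β Ā^{1β}(x₁) D_β u`. -/
def Ubar {d m : ℕ} [NeZero d] (Ab : Fin d → Fin d → ℝ → CLM m)
    (u : ℝ × Ed d → Em m) (q : ℝ × Ed d) : Em m :=
  ∑ β, Ab 0 β (q.2 0) (pd β u q)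

set_option linter.unusedSectionVars false

/-- Smooth functions. -/
abbrev Sm {E F : Type*} [NormedAddCommGroup E] [NormedSpace ℝ E]
    [NormedAddCommGroup F] [NormedSpace ℝ F] (f : E → F) : Prop := ContDiff ℝ (⊤ : ℕ∞) f

/-- Directional derivative. -/
def dd {E F : Type*} [NormedAddCommGroup E] [NormedSpace ℝ E]
    [NormedAddCommGroup F] [NormedSpace ℝ F] (v : E) (f : E → F) (q : E) : F :=
  fderiv ℝ f q v

section
variable {E F : Type*} [NormedAddCommGroup E] [NormedSpace ℝ E]
    [NormedAddCommGroup F] [NormedSpace ℝ F]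

theorem sm_dd {f : E → F} (hf : Sm f) (v : E) : Sm (dd v f) := by
  have : Sm (fderiv ℝ f) := hf.fderiv_right (by exact le_rfl)
  exact this.clm_apply contDiff_const

theorem Sm.da {f : E → F} (hf : Sm f) (q : E) : DifferentiableAt ℝ f q :=
  (hf.differentiable (by simp)) q

theorem dd_comm {f : E → F} (hf : Sm f) (v w : E) : dd v (dd w f) = dd w (dd v f) := by
  funext q
  have h1 : Sm (fderiv ℝ f) := hf.fderiv_right (by exact le_rfl)
  have key : ∀ a b : E, dd a (dd b f) q = fderiv ℝ (fderiv ℝ f) q a b := by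
    intro a b
    have : dd b f = fun x => fderiv ℝ f x b := rfl
    rw [dd, this, fderiv_clm_apply (h1.da q) (by fun_prop)]
    simp
  rw [key, key]
  have hs : IsSymmSndFDerivAt ℝ f q := hf.contDiffAt.isSymmSndFDerivAt (by
    simp only [minSmoothness_of_isRCLikeNormedField]
    exact WithTop.coe_le_coe.2 (le_top : (2 : ℕ∞) ≤ ⊤))
  exact hs v w

theorem dd_congr {f g : E → F} {O : Set E} (hO : IsOpen O) (h : ∀ q ∈ O, f q = g q) (v : E) :
    ∀ q ∈ O, dd v f q = dd v g q := by
  intro q hq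
  have : f =ᶠ[nhds q] g := Filter.eventually_of_mem (hO.mem_nhds hq) h
  rw [dd, dd, this.fderiv_eq]

theorem dd_add {f g : E → F} (hf : Sm f) (hg : Sm g) (v : E) :
    dd v (fun q => f q + g q) = fun q => dd v f q + dd v g q := by
  funext q
  simp only [dd]
  rw [fderiv_fun_add (hf.da q) (hg.da q)]; rfl

theorem dd_sum {ι : Type*} (s : Finset ι) {f : ι → E → F} (hf : ∀ i ∈ s, Sm (f i)) (v : E) :
    dd v (fun q => ∑ i ∈ s, f i q) = fun q => ∑ i ∈ s, dd v (f i) q := by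
  funext q
  simp only [dd]
  rw [fderiv_fun_sum (fun i hi => (hf i hi).da q)]
  simp

end

/-- coordinate vectors -/
def ev (d : ℕ) (i : Fin (d + 1)) : ℝ × Ed d :=
  Fin.cases (motive := fun _ => ℝ × Ed d) ((1 : ℝ), (0 : Ed d))
    (fun α => ((0 : ℝ), EuclideanSpace.single α (1 : ℝ))) i

theorem pt_eq {d : ℕ} {F : Type*} [NormedAddCommGroup F] [NormedSpace ℝ F]
    (u : ℝ × Ed d → F) : pt u = dd (ev d 0) u := rfl

theorem pd_eq {d : ℕ} {F : Type*} [NormedAddCommGroup F] [NormedSpace ℝ F]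
    (α : Fin d) (u : ℝ × Ed d → F) : pd α u = dd (ev d α.succ) u := rfl

theorem norm_ev_le (d : ℕ) (i : Fin (d + 1)) : ‖ev d i‖ ≤ 1 := by
  refine Fin.cases ?_ (fun α => ?_) i
  · simp [ev, Prod.norm_def]
  · simp [ev, Prod.norm_def]

section
variable {d m : ℕ} [NeZero d]

theorem sm_x1 : Sm (fun q : ℝ × Ed d => q.2 0) :=
  ((EuclideanSpace.proj (0 : Fin d) : Ed d →L[ℝ] ℝ).comp (ContinuousLinearMap.snd ℝ ℝ (Ed d))).contDiff

theorem sm_coef {a : ℝ → CLM m} (ha : Sm a) {f : ℝ × Ed d → Em m} (hf : Sm f) :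
    Sm (fun q : ℝ × Ed d => a (q.2 0) (f q)) := by
  have h1 : Sm (fun q : ℝ × Ed d => q.2 0) := sm_x1
  exact (ha.comp h1).clm_apply hf

theorem dd_coef {a : ℝ → CLM m} (ha : Sm a) {f : ℝ × Ed d → Em m} (hf : Sm f)
    {v : ℝ × Ed d} (hv : v.2 0 = 0) :
    dd v (fun q : ℝ × Ed d => a (q.2 0) (f q)) = fun q => a (q.2 0) (dd v f q) := by
  funext q
  have h1 : Sm (fun q : ℝ × Ed d => q.2 0) := sm_x1
  have hz : fderiv ℝ (fun q : ℝ × Ed d => q.2 0) q v = 0 := by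
    have : HasFDerivAt (fun q : ℝ × Ed d => q.2 0)
        ((EuclideanSpace.proj (0 : Fin d) : Ed d →L[ℝ] ℝ).comp (ContinuousLinearMap.snd ℝ ℝ (Ed d))) q :=
      ContinuousLinearMap.hasFDerivAt
        ((EuclideanSpace.proj (0 : Fin d) : Ed d →L[ℝ] ℝ).comp (ContinuousLinearMap.snd ℝ ℝ (Ed d)))
    rw [this.fderiv]; simpa using hv
  simp only [dd]
  have hc : Sm (fun q : ℝ × Ed d => a (q.2 0)) := ha.comp h1
  rw [fderiv_clm_apply (hc.da q) (hf.da q)]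
  have : fderiv ℝ (fun q : ℝ × Ed d => a (q.2 0)) q v = 0 := by
    have : (fun q : ℝ × Ed d => a (q.2 0)) = a ∘ (fun q : ℝ × Ed d => q.2 0) := rfl
    rw [this, fderiv_comp _ (ha.da _) (h1.da q)]
    simp [hz]
  simp [this]

theorem ev_tan {i : Fin (d + 1)} (hi : i ≠ Fin.succ 0) : (ev d i).2 0 = 0 := by
  revert hi
  refine Fin.cases ?_ (fun α => ?_) i
  · intro _; simp [ev]
  · intro h
    have : α ≠ 0 := fun h' => h (by rw [h'])
    simp [ev, this.symm]

/-- flux -/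
def flux (Ab : Fin d → Fin d → ℝ → CLM m) (w : ℝ × Ed d → Em m) (α : Fin d)
    (q : ℝ × Ed d) : Em m := ∑ β, Ab α β (q.2 0) (pd β w q)

theorem sm_flux {Ab : Fin d → Fin d → ℝ → CLM m} (hA : ∀ α β, Sm (Ab α β))
    {w : ℝ × Ed d → Em m} (hw : Sm w) (α : Fin d) : Sm (flux Ab w α) := by
  unfold flux
  apply ContDiff.sum
  intro β _
  exact sm_coef (hA α β) (sm_dd hw _)

theorem dd_flux {Ab : Fin d → Fin d → ℝ → CLM m} (hA : ∀ α β, Sm (Ab α β))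
    {w : ℝ × Ed d → Em m} (hw : Sm w) (α : Fin d) {v : ℝ × Ed d} (hv : v.2 0 = 0) :
    dd v (flux Ab w α) = flux Ab (dd v w) α := by
  unfold flux
  simp only [pd_eq]
  rw [dd_sum _ (fun β _ => sm_coef (hA α β) (sm_dd hw (ev d β.succ)))]
  funext q
  refine Finset.sum_congr rfl fun β _ => ?_
  have := congrFun (dd_coef (hA α β) (sm_dd hw (ev d β.succ)) hv) q
  rw [this, dd_comm hw]

/-- Smooth pointwise solutions in `Q_4`. -/
def Sol (Ab : Fin d → Fin d → ℝ → CLM m) (w : ℝ × Ed d → Em m) : Prop :=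
  Sm w ∧ ∀ q ∈ Qc0 (d := d) 4, pt w q = ∑ α, pd α (flux Ab w α) q

theorem isOpen_Qc0 (r : ℝ) : IsOpen (Qc0 (d := d) r) := isOpen_Ioo.prod isOpen_ball

theorem Sol.dd {Ab : Fin d → Fin d → ℝ → CLM m} (hA : ∀ α β, Sm (Ab α β))
    {w : ℝ × Ed d → Em m} (hw : Sol Ab w) {v : ℝ × Ed d} (hv : v.2 0 = 0) :
    Sol Ab (dd v w) := by
  refine ⟨sm_dd hw.1 v, fun q hq => ?_⟩
  have h := dd_congr (isOpen_Qc0 4) hw.2 v q hq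
  rw [pt_eq, dd_comm hw.1] at h
  simp only [pd_eq] at h ⊢
  rw [pt_eq, h, dd_sum _ (fun α _ => sm_dd (sm_flux hA hw.1 α) (ev d α.succ))]
  refine Finset.sum_congr rfl fun α _ => ?_
  rw [dd_comm (sm_flux hA hw.1 α), dd_flux hA hw.1 α hv]

/-- iterated coordinate derivatives -/
def DL {F : Type*} [NormedAddCommGroup F] [NormedSpace ℝ F]
    (L : List (Fin (d + 1))) (f : ℝ × Ed d → F) : ℝ × Ed d → F :=
  L.foldr (fun i g => dd (ev d i) g) f

section
variable {F : Type*} [NormedAddCommGroup F] [NormedSpace ℝ F]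

theorem sm_DL {f : ℝ × Ed d → F} (hf : Sm f) (L : List (Fin (d + 1))) : Sm (DL L f) := by
  induction L with
  | nil => exact hf
  | cons i L ih => exact sm_dd ih _

theorem DL_perm {f : ℝ × Ed d → F} (hf : Sm f) {L L' : List (Fin (d + 1))} (h : L.Perm L') :
    DL L f = DL L' f := by
  induction h with
  | nil => rfl
  | cons x _ ih => exact congrArg (dd (ev d x)) ih
  | swap x y l => exact dd_comm (sm_DL hf l) _ _
  | trans _ _ h1 h2 => rw [h1, h2]

theorem DL_append (L L' : List (Fin (d + 1))) (f : ℝ × Ed d → F) :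
    DL (L ++ L') f = DL L (DL L' f) := by
  simp [DL, List.foldr_append]

theorem DL_dd {f : ℝ × Ed d → F} (hf : Sm f) (L : List (Fin (d + 1))) (i : Fin (d + 1)) :
    DL L (dd (ev d i) f) = dd (ev d i) (DL L f) := by
  have h1 : DL L (dd (ev d i) f) = DL (L ++ [i]) f := by rw [DL_append]; rfl
  rw [h1, DL_perm hf (List.perm_append_comm (l₁ := L) (l₂ := [i]))]; rfl

theorem DL_congr {f g : ℝ × Ed d → F} {O : Set (ℝ × Ed d)} (hO : IsOpen O)
    (h : ∀ q ∈ O, f q = g q) (L : List (Fin (d + 1))) :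
    ∀ q ∈ O, DL L f q = DL L g q := by
  induction L with
  | nil => exact h
  | cons i L ih => exact dd_congr hO ih _

theorem DL_sum {ι : Type*} (s : Finset ι) {f : ι → ℝ × Ed d → F} (hf : ∀ i ∈ s, Sm (f i))
    (L : List (Fin (d + 1))) :
    DL L (fun q => ∑ i ∈ s, f i q) = fun q => ∑ i ∈ s, DL L (f i) q := by
  induction L with
  | nil => rfl
  | cons i L ih =>
    change dd _ (DL L _) = _
    rw [ih, dd_sum s (fun j hj => sm_DL (hf j hj) L)]; rfl
end

theorem DL_coef {a : ℝ → CLM m} (ha : Sm a) {f : ℝ × Ed d → Em m} (hf : Sm f)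
    (L : List (Fin (d + 1))) (hL : Fin.succ 0 ∉ L) :
    DL L (fun q : ℝ × Ed d => a (q.2 0) (f q)) = fun q => a (q.2 0) (DL L f q) := by
  induction L with
  | nil => rfl
  | cons i L ih =>
    simp only [List.mem_cons, not_or] at hL
    change dd _ (DL L _) = _
    rw [ih hL.2, dd_coef ha (sm_DL hf L) (ev_tan (Ne.symm hL.1))]; rfl

theorem Sol.DL {Ab : Fin d → Fin d → ℝ → CLM m} (hA : ∀ α β, Sm (Ab α β))
    {w : ℝ × Ed d → Em m} (hw : Sol Ab w) (L : List (Fin (d + 1))) (hL : Fin.succ 0 ∉ L) :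
    Sol Ab (DL L w) := by
  induction L with
  | nil => exact hw
  | cons i L ih =>
    simp only [List.mem_cons, not_or] at hL
    exact (ih hL.2).dd hA (ev_tan (Ne.symm hL.1))

end
section
variable {E : Type*} [NormedAddCommGroup E] [NormedSpace ℝ E]

theorem hcs_dd {F : E → ℝ} (hc : HasCompactSupport F) (v : E) : HasCompactSupport (dd v F) :=
  hc.fderiv_apply (𝕜 := ℝ) v

theorem dd_zero_of_notMem {F' : Type*} [NormedAddCommGroup F'] [NormedSpace ℝ F'] {F : E → F'} {q : E}
    (hq : q ∉ tsupport F) (v : E) : dd v F q = 0 := by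
  have : F =ᶠ[nhds q] fun _ => 0 := notMem_tsupport_iff_eventuallyEq.1 hq
  rw [dd, this.fderiv_eq]; simp

theorem integral_dd_zero [MeasurableSpace E] [BorelSpace E] [FiniteDimensional ℝ E]
    (μ : Measure E) [μ.IsAddHaarMeasure] {F : E → ℝ} (hF : Sm F) (hc : HasCompactSupport F) (v : E) :
    ∫ x, dd v F x ∂μ = 0 := by
  have h1 : Integrable (dd v F) μ := (sm_dd hF v).continuous.integrable_of_hasCompactSupport (hcs_dd hc v)
  have h2 : Integrable F μ := hF.continuous.integrable_of_hasCompactSupport hc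
  have := integral_mul_fderiv_eq_neg_fderiv_mul_of_integrable (μ := μ) (f := fun _ : E => (1 : ℝ))
    (g := F) (v := v) (by simp) (by simpa [dd] using! h1) (by simpa using h2) (by simp)
    (fun x _ => hF.da x)
  simpa [dd] using this
end

section
variable {d m : ℕ} [NeZero d]

theorem hcs_slice_right {F : ℝ × Ed d → ℝ} (hc : HasCompactSupport F) (t : ℝ) :
    HasCompactSupport (fun x => F (t, x)) := by
  refine HasCompactSupport.intro (K := Prod.snd '' tsupport F) (hc.isCompact.image continuous_snd) ?_
  intro x hx
  by_contra h
  exact hx ⟨(t, x), subset_tsupport _ h, rfl⟩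

theorem hcs_slice_left {F : ℝ × Ed d → ℝ} (hc : HasCompactSupport F) (x : Ed d) :
    HasCompactSupport (fun t => F (t, x)) := by
  refine HasCompactSupport.intro (K := Prod.fst '' tsupport F) (hc.isCompact.image continuous_fst) ?_
  intro t hx
  by_contra h
  exact hx ⟨(t, x), subset_tsupport _ h, rfl⟩

theorem setInt_Q_eq {F : ℝ × Ed d → ℝ} {R : ℝ}
    (hs : tsupport F ⊆ Ioo (-R ^ 2) (R ^ 2) ×ˢ ball 0 R) (v : ℝ × Ed d) :
    ∫ q in Qc0 R, dd v F q = ∫ q in Iio (0 : ℝ) ×ˢ (univ : Set (Ed d)), dd v F q := by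
  refine (setIntegral_eq_of_subset_of_forall_sdiff_eq_zero
    (measurableSet_Iio.prod MeasurableSet.univ) ?_ ?_).symm
  · rintro ⟨t, x⟩ h
    simp only [Qc0, Qc, mem_prod, mem_Ioo] at h
    simp [h.1.2]
  · rintro ⟨t, x⟩ ⟨h1, h2⟩
    apply dd_zero_of_notMem
    intro h
    have := hs h
    simp only [Qc0, Qc, mem_prod, mem_Ioo, mem_Iio] at h1 h2 this
    exact h2 ⟨⟨by linarith [this.1.1], h1.1⟩, this.2⟩

theorem int_Q_space {F : ℝ × Ed d → ℝ} (hF : Sm F) (hc : HasCompactSupport F) {R : ℝ}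
    (hs : tsupport F ⊆ Ioo (-R ^ 2) (R ^ 2) ×ˢ ball 0 R) (v : Ed d) :
    ∫ q in Qc0 R, dd ((0 : ℝ), v) F q = 0 := by
  rw [setInt_Q_eq hs]
  have hint : Integrable (dd ((0 : ℝ), v) F) volume :=
    (sm_dd hF _).continuous.integrable_of_hasCompactSupport (hcs_dd hc _)
  rw [Measure.volume_eq_prod, setIntegral_prod _ (by rw [← Measure.volume_eq_prod]; exact hint.integrableOn)]
  rw [integral_eq_zero_of_ae]
  refine Filter.Eventually.of_forall fun t => ?_
  have hsl : Sm (fun x : Ed d => F (t, x)) := hF.comp (contDiff_const.prodMk contDiff_id)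
  have := integral_dd_zero (volume : Measure (Ed d)) hsl (hcs_slice_right hc t) v
  simp only [Measure.restrict_univ, Pi.zero_apply]
  refine Eq.trans ?_ this
  congr 1
  funext x
  have h1 : HasFDerivAt (fun x : Ed d => (t, x)) (ContinuousLinearMap.inr ℝ ℝ (Ed d)) x :=
    hasFDerivAt_prodMk_right t x
  have h2 := ((hF.da (t, x)).hasFDerivAt.comp x h1).fderiv
  simp only [dd]
  change _ = fderiv ℝ (F ∘ fun x => (t, x)) x v
  rw [h2]; simp

theorem int_Q_time {F : ℝ × Ed d → ℝ} (hF : Sm F) (hc : HasCompactSupport F) {R : ℝ}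
    (hs : tsupport F ⊆ Ioo (-R ^ 2) (R ^ 2) ×ˢ ball 0 R) (h0 : ∀ q, 0 ≤ F q) :
    0 ≤ ∫ q in Qc0 R, dd ((1 : ℝ), (0 : Ed d)) F q := by
  rw [setInt_Q_eq hs]
  have hint : Integrable (dd ((1 : ℝ), (0 : Ed d)) F) volume :=
    (sm_dd hF _).continuous.integrable_of_hasCompactSupport (hcs_dd hc _)
  rw [Measure.volume_eq_prod, ← Measure.prod_restrict, integral_prod_symm _ (by
    rw [Measure.prod_restrict, ← Measure.volume_eq_prod]; exact hint.integrableOn)]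
  refine integral_nonneg fun x => ?_
  have hsl : Sm (fun t : ℝ => F (t, x)) := hF.comp (contDiff_id.prodMk contDiff_const)
  have := HasCompactSupport.integral_Iic_deriv_eq (hsl.of_le (by simp)) (hcs_slice_left hc x) 0
  rw [integral_Iic_eq_integral_Iio] at this
  have h3 : ∀ t, dd ((1 : ℝ), (0 : Ed d)) F (t, x) = deriv (fun t : ℝ => F (t, x)) t := by
    intro t
    have h1 : HasFDerivAt (fun t : ℝ => (t, x)) (ContinuousLinearMap.inl ℝ ℝ (Ed d)) t :=
      hasFDerivAt_prodMk_left t x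
    have h2 := ((hF.da (t, x)).hasFDerivAt.comp t h1).hasDerivAt.deriv
    change _ = deriv (F ∘ fun t => (t, x)) t
    rw [h2]; simp [dd]
  simp only [Pi.zero_apply, h3, this]
  exact h0 _

theorem int_on_Q {F : Type*} [NormedAddCommGroup F] {g : ℝ × Ed d → F} (hg : Continuous g) (R : ℝ) :
    IntegrableOn g (Qc0 R) := by
  have hK : IsCompact (Icc (0 - R ^ 2) (0 : ℝ) ×ˢ closedBall (0 : Ed d) R) :=
    isCompact_Icc.prod (isCompact_closedBall _ _)
  exact (hg.continuousOn.integrableOn_compact hK).mono_set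
    (prod_mono Ioo_subset_Icc_self ball_subset_closedBall)

/-- A cutoff function for `Q_r ⊂ Q_R`. -/
structure Cut (η : ℝ × Ed d → ℝ) (R M : ℝ) : Prop where
  sm : Sm η
  nn : ∀ q, 0 ≤ η q
  le1 : ∀ q, η q ≤ 1
  hcs : HasCompactSupport η
  supp : tsupport η ⊆ Ioo (-R ^ 2) (R ^ 2) ×ˢ ball 0 R
  bd : ∀ i q, |dd (ev d i) η q| ≤ M

theorem exists_cut {r R : ℝ} (hr : 0 < r) (hR : r < R) :
    ∃ (η : ℝ × Ed d → ℝ) (M : ℝ), 0 < M ∧ Cut η R M ∧ ∀ q ∈ Qc0 r, η q = 1 := by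
  have hsq : r ^ 2 < R ^ 2 := by nlinarith
  let b1 : ContDiffBump (0 : ℝ) := ⟨r ^ 2, (r ^ 2 + R ^ 2) / 2, by positivity, by linarith⟩
  let b2 : ContDiffBump (0 : Ed d) := ⟨r, (r + R) / 2, hr, by linarith⟩
  let η : ℝ × Ed d → ℝ := fun q => b1 q.1 * b2 q.2
  have hsm : Sm η := (b1.contDiff.comp contDiff_fst).mul (b2.contDiff.comp contDiff_snd)
  have hK : IsCompact (closedBall (0 : ℝ) ((r ^ 2 + R ^ 2) / 2) ×ˢ closedBall (0 : Ed d) ((r + R) / 2)) :=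
    (isCompact_closedBall _ _).prod (isCompact_closedBall _ _)
  have hsub : tsupport η ⊆ closedBall (0 : ℝ) ((r ^ 2 + R ^ 2) / 2) ×ˢ closedBall (0 : Ed d) ((r + R) / 2) := by
    refine closure_minimal ?_ hK.isClosed
    intro q hq
    have hq' : b1 q.1 * b2 q.2 ≠ 0 := hq
    have h1 : q.1 ∈ support b1 := left_ne_zero_of_mul hq'
    have h2 : q.2 ∈ support b2 := right_ne_zero_of_mul hq'
    rw [b1.support_eq] at h1
    rw [b2.support_eq] at h2
    exact ⟨ball_subset_closedBall h1, ball_subset_closedBall h2⟩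
  have hcs : HasCompactSupport η := hK.of_isClosed_subset (isClosed_tsupport _) hsub
  have hfc : Continuous (fderiv ℝ η) := hsm.continuous_fderiv (by simp)
  obtain ⟨C, hC⟩ := hfc.bounded_above_of_compact_support (hcs.fderiv (𝕜 := ℝ))
  refine ⟨η, max C 1, by positivity, ⟨hsm, fun q => mul_nonneg b1.nonneg b2.nonneg,
    fun q => mul_le_one₀ b1.le_one b2.nonneg b2.le_one, hcs, ?_, ?_⟩, ?_⟩
  · intro q hq
    have := hsub hq
    simp only [mem_prod, mem_closedBall, dist_zero_right, Real.norm_eq_abs] at this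
    refine ⟨abs_lt.1 (lt_of_le_of_lt this.1 (by linarith)) |>.imp (by intro h; linarith) id, ?_⟩
    simpa using lt_of_le_of_lt this.2 (by linarith)
  · intro i q
    calc |dd (ev d i) η q| = ‖fderiv ℝ η q (ev d i)‖ := rfl
      _ ≤ ‖fderiv ℝ η q‖ * ‖ev d i‖ := ContinuousLinearMap.le_opNorm _ _
      _ ≤ C * 1 := mul_le_mul (hC q) (norm_ev_le d i) (norm_nonneg _) ((norm_nonneg _).trans (hC q))
      _ ≤ max C 1 := by simp
  · rintro ⟨t, x⟩ h
    simp only [Qc0, Qc, mem_prod, mem_Ioo, mem_ball, dist_zero_right] at h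
    have e1 : b1 t = 1 := b1.one_of_mem_closedBall (by
      simp only [mem_closedBall, dist_zero_right, Real.norm_eq_abs]
      rw [abs_of_neg h.1.2]; change -t ≤ r ^ 2; linarith [h.1.1])
    have e2 : b2 x = 1 := b2.one_of_mem_closedBall (by simpa using h.2.le)
    change b1 t * b2 x = 1
    rw [e1, e2, one_mul]

end

section
variable {E : Type*} [NormedAddCommGroup E] [NormedSpace ℝ E] {m : ℕ}

theorem dd_inner {f g : E → Em m} (hf : Sm f) (hg : Sm g) (v q : E) :
    dd v (fun q => ⟪f q, g q⟫) q = ⟪f q, dd v g q⟫ + ⟪dd v f q, g q⟫ :=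
  fderiv_inner_apply ℝ (hf.da q) (hg.da q) v

theorem dd_mul {f g : E → ℝ} (hf : Sm f) (hg : Sm g) (v q : E) :
    dd v (fun q => f q * g q) q = f q * dd v g q + dd v f q * g q := by
  simp only [dd]
  rw [fderiv_fun_mul (hf.da q) (hg.da q)]
  simp [mul_comm]

theorem dd_pow {f : E → ℝ} (hf : Sm f) (n : ℕ) (v q : E) :
    dd v (fun q => f q ^ n) q = n * f q ^ (n - 1) * dd v f q := by
  simp only [dd]
  rw [fderiv_fun_pow n (hf.da q)]
  simp

theorem sm_inner {f g : E → Em m} (hf : Sm f) (hg : Sm g) : Sm (fun q => ⟪f q, g q⟫) :=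
  ContDiff.inner ℝ hf hg
end
section
variable {d m : ℕ} [NeZero d]

theorem sol_of_weak {Ab : Fin d → Fin d → ℝ → CLM m} (hA : ∀ α β, Sm (Ab α β))
    {u : ℝ × Ed d → Em m} (hu : Sm u)
    (hw : ∀ φt : ℝ × Ed d → Em m, ContDiff ℝ (⊤ : ℕ∞) φt → HasCompactSupport φt →
      tsupport φt ⊆ Qc0 4 →
      ∫ q, (⟪u q, pt φt q⟫ - ∑ α, ∑ β, ⟪Ab α β (q.2 0) (pd β u q), pd α φt q⟫) = 0) :
    Sol Ab u := by
  haveI : (volume : Measure (ℝ × Ed d)).IsAddHaarMeasure := by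
    rw [Measure.volume_eq_prod]; infer_instance
  refine ⟨hu, fun q0 hq0 => ?_⟩
  set f : ℝ × Ed d → Em m := fun q => ∑ α, pd α (flux Ab u α) q - pt u q with hf
  have hfs : Sm f := (ContDiff.sum fun α _ => sm_dd (sm_flux hA hu α) _).sub (sm_dd hu _)
  by_contra hne
  obtain ⟨ε, hε, hball⟩ := Metric.isOpen_iff.1 (isOpen_Qc0 (d := d) 4) q0 hq0
  let b : ContDiffBump q0 := ⟨ε / 4, ε / 2, by positivity, by linarith⟩
  have hbs : Sm b := b.contDiff
  set φ : ℝ × Ed d → Em m := fun q => b q • f q with hφ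
  have hφs : Sm φ := hbs.smul hfs
  have hφc : HasCompactSupport φ := b.hasCompactSupport.smul_right
  have hsub : tsupport φ ⊆ Qc0 4 := by
    refine (tsupport_smul_subset_left _ _).trans ?_
    rw [b.tsupport_eq]
    exact (closedBall_subset_ball (by change ε / 2 < ε; linarith)).trans hball
  have h := hw φ hφs hφc hsub
  have hinn : ∀ g : ℝ × Ed d → Em m, HasCompactSupport (fun q => ⟪g q, φ q⟫) := by
    intro g
    refine hφc.mono ?_
    intro q hq
    simp only [mem_support] at hq ⊢
    intro h0; apply hq; rw [h0, inner_zero_right]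
  have hpt : ∀ q, (⟪u q, pt φ q⟫ - ∑ α, ∑ β, ⟪Ab α β (q.2 0) (pd β u q), pd α φ q⟫)
      = dd (ev d 0) (fun q => ⟪u q, φ q⟫) q
        - ∑ α : Fin d, dd (ev d α.succ) (fun q => ⟪flux Ab u α q, φ q⟫) q + b q * ‖f q‖ ^ 2 := by
    intro q
    rw [dd_inner hu hφs]
    simp only [fun α => dd_inner (sm_flux hA hu α) hφs]
    rw [Finset.sum_add_distrib]
    have e1 : ∀ α, ∑ β, ⟪Ab α β (q.2 0) (pd β u q), pd α φ q⟫ = ⟪flux Ab u α q, pd α φ q⟫ := by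
      intro α; rw [flux, sum_inner]
    simp only [e1]
    have e2 : b q * ‖f q‖ ^ 2 = ⟪f q, φ q⟫ := by
      rw [hφ]; simp only [inner_smul_right, real_inner_self_eq_norm_sq]
    rw [e2]
    have e3 : ⟪f q, φ q⟫ = ∑ α, ⟪pd α (flux Ab u α) q, φ q⟫ - ⟪pt u q, φ q⟫ := by
      rw [hf]; simp only [inner_sub_left, sum_inner]
    rw [e3]; simp only [pt_eq, pd_eq]; ring
  simp only [hpt] at h
  have i0 : Integrable (dd (ev d 0) (fun q => ⟪u q, φ q⟫)) (volume : Measure (ℝ × Ed d)) :=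
    (sm_dd (sm_inner hu hφs) _).continuous.integrable_of_hasCompactSupport (hcs_dd (hinn u) _)
  have iα : ∀ α : Fin d, Integrable (dd (ev d α.succ) (fun q => ⟪flux Ab u α q, φ q⟫))
      (volume : Measure (ℝ × Ed d)) := fun α =>
    (sm_dd (sm_inner (sm_flux hA hu α) hφs) _).continuous.integrable_of_hasCompactSupport
      (hcs_dd (hinn _) _)
  have hgc : Continuous fun q => b q * ‖f q‖ ^ 2 :=
    hbs.continuous.mul (hfs.continuous.norm.pow 2)
  have hgs : HasCompactSupport fun q => b q * ‖f q‖ ^ 2 := b.hasCompactSupport.mul_right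
  have ig : Integrable (fun q => b q * ‖f q‖ ^ 2) (volume : Measure (ℝ × Ed d)) :=
    hgc.integrable_of_hasCompactSupport hgs
  have iS : Integrable (fun q => ∑ α : Fin d, dd (ev d α.succ) (fun q => ⟪flux Ab u α q, φ q⟫) q)
      (volume : Measure (ℝ × Ed d)) := integrable_finsetSum _ fun α _ => iα α
  have iD : Integrable (fun q => dd (ev d 0) (fun q => ⟪u q, φ q⟫) q
      - ∑ α : Fin d, dd (ev d α.succ) (fun q => ⟪flux Ab u α q, φ q⟫) q)
      (volume : Measure (ℝ × Ed d)) := i0.sub iS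
  rw [integral_add iD ig, integral_sub i0 iS,
    integral_finsetSum _ (fun α _ => iα α),
    integral_dd_zero _ (sm_inner hu hφs) (hinn u)] at h
  simp only [fun α => integral_dd_zero (volume : Measure (ℝ × Ed d))
    (sm_inner (sm_flux hA hu α) hφs) (hinn _)] at h
  have hpos := hgc.integral_pos_of_hasCompactSupport_nonneg_nonzero (μ := volume) hgs
    (fun q => mul_nonneg b.nonneg (by positivity)) (x := q0) (by
      have : b q0 = 1 := b.one_of_mem_closedBall (by simp [b]; positivity)
      rw [this, one_mul]
      have : f q0 ≠ 0 := fun h0 => hne (sub_eq_zero.1 h0).symm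
      positivity)
  simp at h
  linarith

theorem norm_flux_sq_le {δ : ℝ} {Ab : Fin d → Fin d → ℝ → CLM m} (hC : CoeffsOne δ Ab)
    (w : ℝ × Ed d → Em m) (α : Fin d) (q : ℝ × Ed d) :
    ‖flux Ab w α q‖ ^ 2 ≤ d * δ⁻¹ ^ 2 * gradSq w q := by
  have h1 : ‖flux Ab w α q‖ ≤ ∑ β, δ⁻¹ * ‖pd β w q‖ := by
    refine (norm_sum_le _ _).trans (Finset.sum_le_sum fun β _ => ?_)
    exact (ContinuousLinearMap.le_opNorm _ _).trans
      (mul_le_mul_of_nonneg_right ((hC.2 (q.2 0)).1 α β) (norm_nonneg _))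
  have h2 : (∑ β, δ⁻¹ * ‖pd β w q‖) ^ 2 ≤ (Finset.univ : Finset (Fin d)).card * ∑ β, (δ⁻¹ * ‖pd β w q‖) ^ 2 :=
    sq_sum_le_card_mul_sum_sq
  calc ‖flux Ab w α q‖ ^ 2 ≤ (∑ β, δ⁻¹ * ‖pd β w q‖) ^ 2 := by gcongr
    _ ≤ _ := h2
    _ = d * δ⁻¹ ^ 2 * gradSq w q := by
      simp only [gradSq, mul_pow, Finset.card_univ, Fintype.card_fin]
      rw [← Finset.mul_sum]; ring

theorem gradSq_cont {w : ℝ × Ed d → Em m} (hw : Sm w) : Continuous (gradSq w) := by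
  unfold gradSq
  refine continuous_finsetSum _ fun α _ => ?_
  exact ((sm_dd hw _).continuous.norm.pow 2)

theorem gradSq_nonneg (w : ℝ × Ed d → Em m) (q) : 0 ≤ gradSq w q :=
  Finset.sum_nonneg fun _ _ => by positivity

theorem Qc0_mono {r R : ℝ} (hr : 0 ≤ r) (h : r ≤ R) : Qc0 (d := d) r ⊆ Qc0 R := by
  have : r ^ 2 ≤ R ^ 2 := by gcongr
  exact prod_mono (Ioo_subset_Ioo_left (by linarith)) (ball_subset_ball h)

theorem measQ (R : ℝ) : MeasurableSet (Qc0 (d := d) R) := (isOpen_Qc0 R).measurableSet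

/-- Caccioppoli. -/
theorem lemA {δ : ℝ} (hδ : 0 < δ) {η : ℝ × Ed d → ℝ} {R M : ℝ} (hR0 : 0 ≤ R) (hR : R ≤ 4) (hM : 0 < M)
    (hη : Cut η R M) :
    ∃ C : ℝ, 0 < C ∧ ∀ Ab : Fin d → Fin d → ℝ → CLM m, CoeffsOne δ Ab → (∀ α β, Sm (Ab α β)) →
      ∀ w, Sol Ab w →
      ∫ q in Qc0 R, η q ^ 4 * gradSq w q ≤ C * ∫ q in Qc0 R, η q ^ 2 * ‖w q‖ ^ 2 := by
  have hd : (0 : ℝ) < d := by exact_mod_cast Nat.pos_of_ne_zero (NeZero.ne d)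
  set K : ℝ := d * δ⁻¹ ^ 2 with hK
  have hKp : 0 < K := by positivity
  set C0 : ℝ := 8 * M ^ 2 * d ^ 2 * K / δ + 2 * M with hC0
  refine ⟨2 / δ * C0, by positivity, ?_⟩
  intro Ab hC hA w hw
  have hws := hw.1
  let G : ℝ × Ed d → ℝ := fun q => η q ^ 4 * ⟪w q, w q⟫
  let Fα : Fin d → ℝ × Ed d → ℝ := fun α q => η q ^ 4 * ⟪w q, flux Ab w α q⟫
  have hη4 : Sm (fun q => η q ^ 4) := hη.sm.pow 4
  have hGs : Sm G := hη4.mul (sm_inner hws hws)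
  have hFs : ∀ α, Sm (Fα α) := fun α => hη4.mul (sm_inner hws (sm_flux hA hws α))
  have hηqc : HasCompactSupport (fun q => η q ^ 4) :=
    hη.hcs.comp_left (g := fun x : ℝ => x ^ 4) (by simp)
  have hηqt : tsupport (fun q => η q ^ 4) ⊆ tsupport η :=
    closure_mono (fun q hq => by simp only [mem_support] at hq ⊢; exact fun h => hq (by simp [h]))
  have hGc : HasCompactSupport G := hηqc.mul_right
  have hFc : ∀ α, HasCompactSupport (Fα α) := fun α => hηqc.mul_right
  have hGt : tsupport G ⊆ Ioo (-R ^ 2) (R ^ 2) ×ˢ ball 0 R :=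
    (tsupport_mul_subset_left.trans hηqt).trans hη.supp
  have hFt : ∀ α, tsupport (Fα α) ⊆ Ioo (-R ^ 2) (R ^ 2) ×ˢ ball 0 R := fun α =>
    (tsupport_mul_subset_left.trans hηqt).trans hη.supp
  have hpt : ∀ q ∈ Qc0 (d := d) R, δ / 2 * (η q ^ 4 * gradSq w q) ≤
      C0 * (η q ^ 2 * ‖w q‖ ^ 2) + (∑ α : Fin d, dd (ev d α.succ) (Fα α) q - 1 / 2 * dd (ev d 0) G q) := by
    intro q hq
    have heq := hw.2 q (Qc0_mono hR0 hR hq)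
    have dG : dd (ev d 0) G q = η q ^ 4 * (2 * ⟪w q, pt w q⟫) + 4 * η q ^ 3 * dd (ev d 0) η q * ‖w q‖ ^ 2 := by
      rw [dd_mul hη4 (sm_inner hws hws), dd_inner hws hws, dd_pow hη.sm, pt_eq,
        real_inner_self_eq_norm_sq, real_inner_comm (w q) (dd (ev d 0) w q)]
      push_cast; ring
    have dF : ∀ α : Fin d, dd (ev d α.succ) (Fα α) q = η q ^ 4 * ⟪w q, pd α (flux Ab w α) q⟫
        + η q ^ 4 * ⟪pd α w q, flux Ab w α q⟫
        + 4 * η q ^ 3 * dd (ev d α.succ) η q * ⟪w q, flux Ab w α q⟫ := by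
      intro α
      rw [dd_mul hη4 (sm_inner hws (sm_flux hA hws α)), dd_inner hws (sm_flux hA hws α),
        dd_pow hη.sm, pd_eq, pd_eq]
      push_cast; ring
    simp only [dF]
    rw [Finset.sum_add_distrib, Finset.sum_add_distrib, dG, heq, inner_sum, ← Finset.mul_sum,
      ← Finset.mul_sum]
    have hell : δ * gradSq w q ≤ ∑ α, ⟪pd α w q, flux Ab w α q⟫ := by
      have := (hC.2 (q.2 0)).2 (fun α => pd α w q)
      simp only [flux, inner_sum]
      exact this
    have hη0 := hη.nn q
    have hη1 := hη.le1 q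
    -- cross terms
    have hcross : ∀ α : Fin d, -(δ / (2 * d) * (η q ^ 4 * gradSq w q)
        + 8 * M ^ 2 * d * K / δ * (η q ^ 2 * ‖w q‖ ^ 2)) ≤
        4 * η q ^ 3 * dd (ev d α.succ) η q * ⟪w q, flux Ab w α q⟫ := by
      intro α
      have h1 : |⟪w q, flux Ab w α q⟫| ≤ ‖w q‖ * ‖flux Ab w α q‖ := abs_real_inner_le_norm _ _
      have h2 := hη.bd α.succ q
      have h3 := norm_flux_sq_le hC w α q
      rw [← hK] at h3
      set g := gradSq w q
      set V := ‖flux Ab w α q‖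
      set W := ‖w q‖
      have hV : 0 ≤ V := norm_nonneg _
      have hW : 0 ≤ W := norm_nonneg _
      have h4 : |4 * η q ^ 3 * dd (ev d α.succ) η q * ⟪w q, flux Ab w α q⟫| ≤ 4 * η q ^ 3 * M * (W * V) := by
        rw [abs_mul, abs_mul, abs_of_nonneg (by positivity : (0:ℝ) ≤ 4 * η q ^ 3)]
        gcongr
      have h5 : 4 * η q ^ 3 * M * (W * V) ≤ δ / (2 * d) * (η q ^ 4 * g) + 8 * M ^ 2 * d * K / δ * (η q ^ 2 * W ^ 2) := by
        have e : δ / (2 * d * K) * (η q ^ 4 * V ^ 2) ≤ δ / (2 * d) * (η q ^ 4 * g) := by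
          have : δ / (2 * d) * (η q ^ 4 * g) = δ / (2 * d * K) * (η q ^ 4 * (K * g)) := by
            field_simp
          rw [this]; gcongr
        have e2 : 4 * η q ^ 3 * M * (W * V) ≤ δ / (2 * d * K) * (η q ^ 4 * V ^ 2) + 8 * M ^ 2 * d * K / δ * (η q ^ 2 * W ^ 2) := by
          have e3 : δ / (2 * d * K) * (η q ^ 4 * V ^ 2) + 8 * M ^ 2 * d * K / δ * (η q ^ 2 * W ^ 2)
            - 4 * η q ^ 3 * M * (W * V) = δ / (2 * d * K) * (η q ^ 2 * V - 4 * M * d * K / δ * (η q * W)) ^ 2 := by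
            field_simp; ring
          have : 0 ≤ δ / (2 * d * K) * (η q ^ 2 * V - 4 * M * d * K / δ * (η q * W)) ^ 2 := by positivity
          linarith
        linarith
      have := (abs_le.1 h4).1
      linarith
    have hcs := Finset.sum_le_sum (s := Finset.univ) fun α _ => hcross α
    rw [Finset.sum_const, Finset.card_univ, Fintype.card_fin, nsmul_eq_mul] at hcs
    have hcs' : -(δ / 2 * (η q ^ 4 * gradSq w q) + 8 * M ^ 2 * d ^ 2 * K / δ * (η q ^ 2 * ‖w q‖ ^ 2)) =
        d * -(δ / (2 * d) * (η q ^ 4 * gradSq w q) + 8 * M ^ 2 * d * K / δ * (η q ^ 2 * ‖w q‖ ^ 2)) := by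
      field_simp
    have ht : |4 * η q ^ 3 * dd (ev d 0) η q * ‖w q‖ ^ 2| ≤ 4 * M * (η q ^ 2 * ‖w q‖ ^ 2) := by
      have h2 := hη.bd 0 q
      rw [abs_mul, abs_mul, abs_of_nonneg (by positivity : (0:ℝ) ≤ 4 * η q ^ 3),
        abs_of_nonneg (by positivity : (0:ℝ) ≤ ‖w q‖ ^ 2)]
      have : η q ^ 3 ≤ η q ^ 2 := pow_le_pow_of_le_one hη0 hη1 (by norm_num)
      calc 4 * η q ^ 3 * |dd (ev d 0) η q| * ‖w q‖ ^ 2 ≤ 4 * η q ^ 2 * M * ‖w q‖ ^ 2 := by gcongr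
        _ = _ := by ring
    have ht' := (abs_le.1 ht).1
    have ht2 := (abs_le.1 ht).2
    have hell' : η q ^ 4 * (δ * gradSq w q) ≤ η q ^ 4 * ∑ α, ⟪pd α w q, flux Ab w α q⟫ := by gcongr
    have : C0 * (η q ^ 2 * ‖w q‖ ^ 2) = 8 * M ^ 2 * d ^ 2 * K / δ * (η q ^ 2 * ‖w q‖ ^ 2) + 2 * M * (η q ^ 2 * ‖w q‖ ^ 2) := by
      rw [hC0]; ring
    rw [this]
    linarith
  have cη := hη.sm.continuous
  have ig : IntegrableOn (fun q => η q ^ 4 * gradSq w q) (Qc0 R) :=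
    int_on_Q ((cη.pow 4).mul (gradSq_cont hws)) R
  have iw : IntegrableOn (fun q => η q ^ 2 * ‖w q‖ ^ 2) (Qc0 R) :=
    int_on_Q ((cη.pow 2).mul (hws.continuous.norm.pow 2)) R
  have iF : ∀ α : Fin d, IntegrableOn (fun q => dd (ev d α.succ) (Fα α) q) (Qc0 R) :=
    fun α => int_on_Q (sm_dd (hFs α) _).continuous R
  have iG : IntegrableOn (fun q => dd (ev d 0) G q) (Qc0 R) := int_on_Q (sm_dd hGs _).continuous R
  have iS : IntegrableOn (fun q => ∑ α : Fin d, dd (ev d α.succ) (Fα α) q) (Qc0 R) :=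
    integrable_finsetSum _ fun α _ => iF α
  have iD : IntegrableOn (fun q => ∑ α : Fin d, dd (ev d α.succ) (Fα α) q - 1 / 2 * dd (ev d 0) G q)
      (Qc0 R) := iS.sub (iG.const_mul (1/2))
  have hI := setIntegral_mono_on (ig.const_mul (δ / 2))
    ((iw.const_mul C0).add iD)
    (measQ R) hpt
  simp only [Pi.add_apply] at hI
  rw [integral_const_mul, integral_add (iw.const_mul C0) iD,
    integral_const_mul, integral_sub iS (iG.const_mul (1/2)),
    integral_finsetSum _ (fun α _ => iF α), integral_const_mul] at hI
  have z : ∀ α : Fin d, ∫ q in Qc0 R, dd (ev d α.succ) (Fα α) q = 0 := fun α =>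
    int_Q_space (hFs α) (hFc α) (hFt α) _
  have p : 0 ≤ ∫ q in Qc0 R, dd (ev d 0) G q := int_Q_time hGs hGc hGt (fun q => by
    have : (0:ℝ) ≤ ⟪w q, w q⟫ := real_inner_self_nonneg
    have := hη.nn q
    positivity)
  simp only [z, Finset.sum_const_zero] at hI
  set X := ∫ q in Qc0 R, η q ^ 4 * gradSq w q
  set Y := ∫ q in Qc0 R, η q ^ 2 * ‖w q‖ ^ 2
  have : X = 2 / δ * (δ / 2 * X) := by field_simp
  rw [this, mul_assoc]
  exact mul_le_mul_of_nonneg_left (by linarith) (by positivity)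
end
section
variable {d m : ℕ} [NeZero d]

/-- Estimate of the time derivative. -/
theorem lemB {δ : ℝ} (hδ : 0 < δ) {η : ℝ × Ed d → ℝ} {R M : ℝ} (hR0 : 0 ≤ R) (hR : R ≤ 4) (hM : 0 < M)
    (hη : Cut η R M) :
    ∃ C : ℝ, 0 < C ∧ ∀ Ab : Fin d → Fin d → ℝ → CLM m, CoeffsOne δ Ab → (∀ α β, Sm (Ab α β)) →
      ∀ w, Sol Ab w →
      ∫ q in Qc0 R, η q ^ 2 * ‖pt w q‖ ^ 2 ≤ C * ∫ q in Qc0 R, gradSq w q := by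
  obtain ⟨C1, hC1, hlemA⟩ := lemA (m := m) hδ hR0 hR hM hη
  have hd : (0 : ℝ) < d := by exact_mod_cast Nat.pos_of_ne_zero (NeZero.ne d)
  set K : ℝ := d * δ⁻¹ ^ 2 with hK
  have hKp : 0 < K := by positivity
  set ε : ℝ := 1 / (4 * C1) with hε
  have hεp : 0 < ε := by positivity
  set C' : ℝ := (1 / (4 * ε) + 4 * d * M ^ 2) * d * K with hC'
  refine ⟨2 * C', by positivity, ?_⟩
  intro Ab hC hA w hw
  have hws := hw.1
  set w' : ℝ × Ed d → Em m := dd (ev d 0) w with hw'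
  have hsol' : Sol Ab w' := hw.dd hA (by simp [ev])
  have hws' := hsol'.1
  have hcac := hlemA Ab hC hA w' hsol'
  let G : Fin d → ℝ × Ed d → ℝ := fun α q => η q ^ 2 * ⟪w' q, flux Ab w α q⟫
  have hη2 : Sm (fun q => η q ^ 2) := hη.sm.pow 2
  have hGs : ∀ α, Sm (G α) := fun α => hη2.mul (sm_inner hws' (sm_flux hA hws α))
  have hηsc : HasCompactSupport (fun q => η q ^ 2) :=
    hη.hcs.comp_left (g := fun x : ℝ => x ^ 2) (by simp)
  have hηst : tsupport (fun q => η q ^ 2) ⊆ tsupport η :=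
    closure_mono (fun q hq => by simp only [mem_support] at hq ⊢; exact fun h => hq (by simp [h]))
  have hGc : ∀ α, HasCompactSupport (G α) := fun α => hηsc.mul_right
  have hGt : ∀ α, tsupport (G α) ⊆ Ioo (-R ^ 2) (R ^ 2) ×ˢ ball 0 R := fun α =>
    (tsupport_mul_subset_left.trans hηst).trans hη.supp
  have hpt : ∀ q ∈ Qc0 (d := d) R, η q ^ 2 * ‖w' q‖ ^ 2 ≤
      ∑ α : Fin d, dd (ev d α.succ) (G α) q + (ε * (η q ^ 4 * gradSq w' q)
        + (1 / 4 * (η q ^ 2 * ‖w' q‖ ^ 2) + C' * gradSq w q)) := by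
    intro q hq
    have heq := hw.2 q (Qc0_mono hR0 hR hq)
    have dG : ∀ α : Fin d, dd (ev d α.succ) (G α) q = η q ^ 2 * ⟪w' q, pd α (flux Ab w α) q⟫
        + (η q ^ 2 * ⟪pd α w' q, flux Ab w α q⟫
        + 2 * η q * dd (ev d α.succ) η q * ⟪w' q, flux Ab w α q⟫) := by
      intro α
      rw [dd_mul hη2 (sm_inner hws' (sm_flux hA hws α)), dd_inner hws' (sm_flux hA hws α),
        dd_pow hη.sm, pd_eq, pd_eq]
      push_cast; ring
    have hη0 := hη.nn q
    have hη1 := hη.le1 q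
    have hcross : ∀ α : Fin d, -(ε * (η q ^ 4 * ‖pd α w' q‖ ^ 2) + (1 / (4 * d) * (η q ^ 2 * ‖w' q‖ ^ 2)
        + (1 / (4 * ε) + 4 * d * M ^ 2) * (K * gradSq w q))) ≤
        η q ^ 2 * ⟪pd α w' q, flux Ab w α q⟫
        + 2 * η q * dd (ev d α.succ) η q * ⟪w' q, flux Ab w α q⟫ := by
      intro α
      have h1 : |⟪w' q, flux Ab w α q⟫| ≤ ‖w' q‖ * ‖flux Ab w α q‖ := abs_real_inner_le_norm _ _
      have h1' : |⟪pd α w' q, flux Ab w α q⟫| ≤ ‖pd α w' q‖ * ‖flux Ab w α q‖ := abs_real_inner_le_norm _ _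
      have h2 := hη.bd α.succ q
      have h3 := norm_flux_sq_le hC w α q
      rw [← hK] at h3
      set g := gradSq w q
      set V := ‖flux Ab w α q‖
      set W := ‖w' q‖
      set P := ‖pd α w' q‖
      have hV : 0 ≤ V := norm_nonneg _
      have hW : 0 ≤ W := norm_nonneg _
      have hP : 0 ≤ P := norm_nonneg _
      have h4 : |2 * η q * dd (ev d α.succ) η q * ⟪w' q, flux Ab w α q⟫| ≤ 2 * η q * M * (W * V) := by
        rw [abs_mul, abs_mul, abs_of_nonneg (by positivity : (0:ℝ) ≤ 2 * η q)]
        gcongr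
      have h4' : |η q ^ 2 * ⟪pd α w' q, flux Ab w α q⟫| ≤ η q ^ 2 * (P * V) := by
        rw [abs_mul, abs_of_nonneg (by positivity : (0:ℝ) ≤ η q ^ 2)]
        gcongr
      have e1 : 2 * η q * M * (W * V) ≤ 1 / (4 * d) * (η q ^ 2 * W ^ 2) + 4 * d * M ^ 2 * V ^ 2 := by
        have : 1 / (4 * d) * (η q ^ 2 * W ^ 2) + 4 * d * M ^ 2 * V ^ 2 - 2 * η q * M * (W * V)
          = 1 / (4 * d) * (η q * W - 4 * d * M * V) ^ 2 := by field_simp; ring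
        have : 0 ≤ 1 / (4 * d) * (η q * W - 4 * d * M * V) ^ 2 := by positivity
        linarith
      have e2 : η q ^ 2 * (P * V) ≤ ε * (η q ^ 4 * P ^ 2) + 1 / (4 * ε) * V ^ 2 := by
        have : ε * (η q ^ 4 * P ^ 2) + 1 / (4 * ε) * V ^ 2 - η q ^ 2 * (P * V)
          = ε * (η q ^ 2 * P - V / (2 * ε)) ^ 2 := by field_simp; ring
        have : 0 ≤ ε * (η q ^ 2 * P - V / (2 * ε)) ^ 2 := by positivity
        linarith
      have e3 : (1 / (4 * ε) + 4 * d * M ^ 2) * V ^ 2 ≤ (1 / (4 * ε) + 4 * d * M ^ 2) * (K * g) := by gcongr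
      have := (abs_le.1 h4).1
      have := (abs_le.1 h4').1
      nlinarith
    have hcs := Finset.sum_le_sum (s := Finset.univ) fun α _ => hcross α
    rw [Finset.sum_neg_distrib, Finset.sum_add_distrib, ← Finset.mul_sum, ← Finset.mul_sum,
      Finset.sum_const, Finset.card_univ, Fintype.card_fin, nsmul_eq_mul] at hcs
    have e4 : (d : ℝ) * (1 / (4 * d) * (η q ^ 2 * ‖w' q‖ ^ 2)
        + (1 / (4 * ε) + 4 * d * M ^ 2) * (K * gradSq w q)) =
        1 / 4 * (η q ^ 2 * ‖w' q‖ ^ 2) + C' * gradSq w q := by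
      rw [hC']; field_simp
    rw [e4] at hcs
    simp only [dG]
    rw [Finset.sum_add_distrib, ← Finset.mul_sum, ← inner_sum, ← heq, pt_eq, ← hw',
      real_inner_self_eq_norm_sq]
    have : ∑ α, ‖pd α w' q‖ ^ 2 = gradSq w' q := rfl
    rw [this] at hcs
    linarith
  have cη := hη.sm.continuous
  have ig : IntegrableOn (fun q => η q ^ 4 * gradSq w' q) (Qc0 R) :=
    int_on_Q ((cη.pow 4).mul (gradSq_cont hws')) R
  have iw : IntegrableOn (fun q => η q ^ 2 * ‖w' q‖ ^ 2) (Qc0 R) :=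
    int_on_Q ((cη.pow 2).mul (hws'.continuous.norm.pow 2)) R
  have ie : IntegrableOn (fun q => gradSq w q) (Qc0 R) := int_on_Q (gradSq_cont hws) R
  have iF : ∀ α : Fin d, IntegrableOn (fun q => dd (ev d α.succ) (G α) q) (Qc0 R) :=
    fun α => int_on_Q (sm_dd (hGs α) _).continuous R
  have iS : IntegrableOn (fun q => ∑ α : Fin d, dd (ev d α.succ) (G α) q) (Qc0 R) :=
    integrable_finsetSum _ fun α _ => iF α
  have i1 : IntegrableOn (fun q => 1 / 4 * (η q ^ 2 * ‖w' q‖ ^ 2) + C' * gradSq w q) (Qc0 R) :=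
    (iw.const_mul (1/4)).add (ie.const_mul C')
  have i2 : IntegrableOn (fun q => ε * (η q ^ 4 * gradSq w' q)
      + (1 / 4 * (η q ^ 2 * ‖w' q‖ ^ 2) + C' * gradSq w q)) (Qc0 R) := (ig.const_mul ε).add i1
  have hI := setIntegral_mono_on iw (iS.add i2) (measQ R) hpt
  simp only [Pi.add_apply] at hI
  rw [integral_add iS i2, integral_add (ig.const_mul ε) i1, integral_add (iw.const_mul (1/4)) (ie.const_mul C'),
    integral_finsetSum _ (fun α _ => iF α), integral_const_mul, integral_const_mul, integral_const_mul] at hI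
  have z : ∀ α : Fin d, ∫ q in Qc0 R, dd (ev d α.succ) (G α) q = 0 := fun α =>
    int_Q_space (hGs α) (hGc α) (hGt α) _
  simp only [z, Finset.sum_const_zero] at hI
  rw [pt_eq, ← hw']
  set X := ∫ q in Qc0 R, η q ^ 2 * ‖w' q‖ ^ 2
  set Y := ∫ q in Qc0 R, η q ^ 4 * gradSq w' q
  set Z := ∫ q in Qc0 R, gradSq w q
  have : ε * Y ≤ 1 / 4 * X := by
    calc ε * Y ≤ ε * (C1 * X) := by gcongr
      _ = 1 / 4 * X := by rw [hε]; field_simp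
  linarith

theorem setInt_le_of_cut {η : ℝ × Ed d → ℝ} {r R M : ℝ} (hr : 0 ≤ r) (hrR : r ≤ R)
    (hη : Cut η R M) (h1 : ∀ q ∈ Qc0 r, η q = 1) {g : ℝ × Ed d → ℝ} (hg : Continuous g)
    (h0 : ∀ q, 0 ≤ g q) (n : ℕ) :
    ∫ q in Qc0 r, g q ≤ ∫ q in Qc0 R, η q ^ n * g q := by
  have : ∫ q in Qc0 r, g q = ∫ q in Qc0 r, η q ^ n * g q :=
    setIntegral_congr_fun (measQ r) fun q hq => by simp [h1 q hq]
  rw [this]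
  refine setIntegral_mono_set (int_on_Q ((hη.sm.continuous.pow n).mul hg) R) ?_ ?_
  · exact Filter.Eventually.of_forall fun q => mul_nonneg (pow_nonneg (hη.nn q) n) (h0 q)
  · exact (Qc0_mono hr hrR).eventuallyLE

/-- One step: tangential derivatives. -/
theorem step {δ : ℝ} (hδ : 0 < δ) {r R : ℝ} (hr : 0 < r) (hrR : r < R) (hR : R ≤ 4) :
    ∃ C : ℝ, 0 < C ∧ ∀ Ab : Fin d → Fin d → ℝ → CLM m, CoeffsOne δ Ab → (∀ α β, Sm (Ab α β)) →
      ∀ w, Sol Ab w →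
      (∫ q in Qc0 r, ‖pt w q‖ ^ 2 ≤ C * ∫ q in Qc0 R, gradSq w q) ∧
      ∀ i : Fin (d + 1), i ≠ Fin.succ 0 →
      ∫ q in Qc0 r, gradSq (dd (ev d i) w) q ≤ C * ∫ q in Qc0 R, gradSq w q := by
  obtain ⟨η, M, hM, hη, h1⟩ := exists_cut (d := d) hr hrR
  have hR0 : 0 ≤ R := by linarith
  obtain ⟨CA, hCA, hA'⟩ := lemA (m := m) hδ hR0 hR hM hη
  obtain ⟨CB, hCB, hB'⟩ := lemB (m := m) hδ hR0 hR hM hη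
  refine ⟨CB + CA * (CB + 1), by positivity, ?_⟩
  intro Ab hC hA w hw
  have hB := hB' Ab hC hA w hw
  have hZ : 0 ≤ ∫ q in Qc0 R, gradSq w q := integral_nonneg fun q => gradSq_nonneg w q
  constructor
  · have := setInt_le_of_cut hr.le hrR.le hη h1 ((sm_dd hw.1 (ev d 0)).continuous.norm.pow 2)
      (fun q => sq_nonneg _) 2
    refine this.trans (hB.trans ?_)
    gcongr
    nlinarith
  · intro i hi
    have hs := hw.dd hA (ev_tan hi)
    have h2 := setInt_le_of_cut hr.le hrR.le hη h1 (gradSq_cont hs.1) (gradSq_nonneg _) 4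
    have h3 := hA' Ab hC hA _ hs
    have h4 : ∫ q in Qc0 R, η q ^ 2 * ‖dd (ev d i) w q‖ ^ 2 ≤ (CB + 1) * ∫ q in Qc0 R, gradSq w q := by
      revert hi
      refine Fin.cases ?_ (fun α => ?_) i
      · intro _
        refine hB.trans ?_
        gcongr; linarith
      · intro _
        have : ∫ q in Qc0 R, η q ^ 2 * ‖dd (ev d α.succ) w q‖ ^ 2 ≤ ∫ q in Qc0 R, gradSq w q := by
          refine setIntegral_mono (int_on_Q ((hη.sm.continuous.pow 2).mul
            ((sm_dd hw.1 _).continuous.norm.pow 2)) R) (int_on_Q (gradSq_cont hw.1) R) ?_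
          intro q
          have a : η q ^ 2 ≤ 1 := pow_le_one₀ (hη.nn q) (hη.le1 q)
          have b : ‖dd (ev d α.succ) w q‖ ^ 2 ≤ gradSq w q :=
            Finset.single_le_sum (f := fun α => ‖pd α w q‖ ^ 2) (fun _ _ => by positivity)
              (Finset.mem_univ α)
          calc η q ^ 2 * ‖dd (ev d α.succ) w q‖ ^ 2 ≤ 1 * ‖dd (ev d α.succ) w q‖ ^ 2 := by gcongr
            _ ≤ _ := by rw [one_mul]; exact b
        nlinarith
    calc _ ≤ _ := h2
      _ ≤ _ := h3
      _ ≤ CA * ((CB + 1) * ∫ q in Qc0 R, gradSq w q) := by gcongr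
      _ ≤ _ := by nlinarith

theorem iter {δ : ℝ} (hδ : 0 < δ) (k : ℕ) : ∀ {r R : ℝ}, 0 < r → r < R → R ≤ 4 →
    ∃ C : ℝ, 0 < C ∧ ∀ Ab : Fin d → Fin d → ℝ → CLM m, CoeffsOne δ Ab → (∀ α β, Sm (Ab α β)) →
      ∀ w, Sol Ab w → ∀ L : List (Fin (d + 1)), Fin.succ 0 ∉ L → L.length ≤ k →
      ∫ q in Qc0 r, gradSq (DL L w) q ≤ C * ∫ q in Qc0 R, gradSq w q := by
  induction k with
  | zero =>
    intro r R hr hrR hR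
    refine ⟨1, one_pos, fun Ab hC hA w hw L _ hL => ?_⟩
    have : L = [] := List.length_eq_zero_iff.1 (by omega)
    subst this
    rw [one_mul]
    exact setIntegral_mono_set (int_on_Q (gradSq_cont hw.1) R)
      (Filter.Eventually.of_forall fun q => gradSq_nonneg w q) (Qc0_mono hr.le hrR.le).eventuallyLE
  | succ k ih =>
    intro r R hr hrR hR
    obtain ⟨C1, hC1, h1⟩ := step (d := d) (m := m) hδ (r := r) (R := (r + R) / 2) hr (by linarith) (by linarith)
    obtain ⟨C2, hC2, h2⟩ := ih (r := (r + R) / 2) (R := R) (by linarith) (by linarith) hR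
    refine ⟨C1 * C2 + C2, by positivity, fun Ab hC hA w hw L hL hlen => ?_⟩
    have hZ : 0 ≤ ∫ q in Qc0 R, gradSq w q := integral_nonneg fun q => gradSq_nonneg w q
    cases L with
    | nil =>
      have a := h2 Ab hC hA w hw [] (by simp) (by simp)
      have b : ∫ q in Qc0 r, gradSq w q ≤ ∫ q in Qc0 ((r + R) / 2), gradSq w q :=
        setIntegral_mono_set (int_on_Q (gradSq_cont hw.1) _)
          (Filter.Eventually.of_forall fun q => gradSq_nonneg w q)
          (Qc0_mono hr.le (by linarith)).eventuallyLE
      have : 0 ≤ C1 * C2 * ∫ q in Qc0 R, gradSq w q := by positivity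
      change ∫ q in Qc0 r, gradSq w q ≤ _
      change ∫ q in Qc0 ((r + R) / 2), gradSq w q ≤ _ at a
      linarith
    | cons i L =>
      simp only [List.mem_cons, not_or] at hL
      simp only [List.length_cons] at hlen
      have a := h2 Ab hC hA w hw L hL.2 (by omega)
      have b := (h1 Ab hC hA _ (hw.DL hA L hL.2)).2 i (Ne.symm hL.1)
      calc _ ≤ _ := b
        _ ≤ C1 * (C2 * ∫ q in Qc0 R, gradSq w q) := by gcongr
        _ ≤ _ := by nlinarith
end

section
variable {d m : ℕ} [NeZero d]

theorem DL_flux {Ab : Fin d → Fin d → ℝ → CLM m} (hA : ∀ α β, Sm (Ab α β))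
    {w : ℝ × Ed d → Em m} (hw : Sm w) (α : Fin d) (L : List (Fin (d + 1)))
    (hL : Fin.succ 0 ∉ L) : DL L (flux Ab w α) = flux Ab (DL L w) α := by
  induction L with
  | nil => rfl
  | cons i L ih =>
    have h1 : Fin.succ 0 ∉ L := fun h => hL (List.mem_cons_of_mem _ h)
    have h2 : i ≠ Fin.succ 0 := fun h => hL (h ▸ List.mem_cons_self)
    have : DL (i :: L) (flux Ab w α) = dd (ev d i) (DL L (flux Ab w α)) := rfl
    rw [this, ih h1, dd_flux hA (sm_DL hw L) α (ev_tan h2)]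
    rfl

theorem pd_sq_le (w : ℝ × Ed d → Em m) (α : Fin d) (q : ℝ × Ed d) :
    ‖dd (ev d α.succ) w q‖ ^ 2 ≤ gradSq w q :=
  Finset.single_le_sum (f := fun α => ‖pd α w q‖ ^ 2) (fun _ _ => by positivity)
    (Finset.mem_univ α)

theorem mixed {δ : ℝ} (hδ : 0 < δ) :
    ∃ C : ℝ, 0 < C ∧ ∀ Ab : Fin d → Fin d → ℝ → CLM m, CoeffsOne δ Ab → (∀ α β, Sm (Ab α β)) →
      ∀ u, Sol Ab u → ∀ S : List (Fin (d + 1)), S.Nodup →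
      (∫ q in Qc0 3, ‖DL S (flux Ab u 0) q‖ ^ 2 ≤ C * ∫ q in Qc0 4, gradSq u q) ∧
      ∀ α : Fin d, α ≠ 0 →
      ∫ q in Qc0 3, ‖DL S (pd α u) q‖ ^ 2 ≤ C * ∫ q in Qc0 4, gradSq u q := by
  obtain ⟨C1, hC1, h1⟩ := step (d := d) (m := m) hδ (r := 3) (R := 7 / 2) (by norm_num)
    (by norm_num) (by norm_num)
  obtain ⟨C2, hC2, h2⟩ := iter (d := d) (m := m) hδ (d + 2) (r := 3) (R := 4) (by norm_num)
    (by norm_num) (by norm_num)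
  obtain ⟨C3, hC3, h3⟩ := iter (d := d) (m := m) hδ (d + 2) (r := 7 / 2) (R := 4) (by norm_num)
    (by norm_num) (by norm_num)
  refine ⟨C2 + d * δ⁻¹ ^ 2 * C2 + (2 * (C1 * C3) + 2 * d * (d * (d * δ⁻¹ ^ 2 * C2))),
    by positivity, ?_⟩
  intro Ab hC hA u hu S hS
  set E := ∫ q in Qc0 4, gradSq u q with hE
  have hE0 : 0 ≤ E := integral_nonneg fun q => gradSq_nonneg u q
  have hlen : S.length ≤ d + 1 := by
    simpa using hS.length_le_card
  -- a pointwise bound by a constant multiple of the gradient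
  have key : ∀ (g : ℝ × Ed d → Em m), Sm g → ∀ K : ℝ, 0 ≤ K → ∀ L : List (Fin (d + 1)),
      Fin.succ 0 ∉ L → L.length ≤ d + 2 →
      (∀ q, ‖g q‖ ^ 2 ≤ K * gradSq (DL L u) q) → ∫ q in Qc0 3, ‖g q‖ ^ 2 ≤ K * C2 * E := by
    intro g hg K hK L hL hLl hb
    calc ∫ q in Qc0 3, ‖g q‖ ^ 2 ≤ ∫ q in Qc0 3, K * gradSq (DL L u) q :=
          setIntegral_mono (int_on_Q (hg.continuous.norm.pow 2) 3)
            (int_on_Q (continuous_const.mul (gradSq_cont (sm_DL hu.1 L))) 3) hb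
      _ = K * ∫ q in Qc0 3, gradSq (DL L u) q := integral_const_mul _ _
      _ ≤ K * (C2 * E) := by
          gcongr
          exact h2 Ab hC hA u hu L hL hLl
      _ = _ := by ring
  have n1 : 0 ≤ d * δ⁻¹ ^ 2 * C2 * E := by positivity
  have n2 : 0 ≤ C2 * E := by positivity
  have n3 : 0 ≤ (2 * (C1 * C3) + 2 * d * (d * (d * δ⁻¹ ^ 2 * C2))) * E := by positivity
  have hfl := sm_flux hA hu.1 (0 : Fin d)
  by_cases h0 : Fin.succ 0 ∈ S
  · set T := S.erase (Fin.succ 0) with hT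
    have hp : S.Perm (T ++ [Fin.succ 0]) :=
      (List.perm_cons_erase h0).trans (List.perm_append_comm (l₁ := [Fin.succ 0]) (l₂ := T))
    have hT0 : Fin.succ 0 ∉ T := hS.not_mem_erase
    have hTl : T.length ≤ d + 1 := (List.length_erase_le).trans hlen
    have hTa : ∀ α : Fin d, α ≠ 0 → Fin.succ 0 ∉ T ++ [α.succ] := by
      intro α hα h
      rcases List.mem_append.1 h with h | h
      · exact hT0 h
      · simp only [List.mem_singleton] at h
        exact hα (Fin.succ_injective _ h).symm
    have hTal : ∀ α : Fin d, (T ++ [α.succ]).length ≤ d + 2 := by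
      intro α; simp; omega
    constructor
    · rw [DL_perm hfl hp, DL_append]
      change ∫ q in Qc0 3, ‖DL T (dd (ev d (Fin.succ 0)) (flux Ab u 0)) q‖ ^ 2 ≤ _
      have hpt : ∀ q ∈ Qc0 (d := d) 4, DL T (dd (ev d (Fin.succ 0)) (flux Ab u 0)) q
          = dd (ev d 0) (DL T u) q - ∑ α ∈ Finset.univ.erase (0 : Fin d),
            flux Ab (DL (T ++ [α.succ]) u) α q := by
        intro q hq
        have e := DL_congr (isOpen_Qc0 4) hu.2 T q hq
        rw [DL_sum (f := fun α => pd α (flux Ab u α)) _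
          (fun α _ => sm_dd (sm_flux hA hu.1 α) (ev d α.succ))] at e
        rw [pt_eq, DL_dd hu.1] at e
        beta_reduce at e
        rw [e, ← Finset.add_sum_erase _ _ (Finset.mem_univ (0 : Fin d))]
        rw [eq_sub_iff_add_eq]
        congr 1
        refine Finset.sum_congr rfl fun α hα => ?_
        have hα' := Finset.ne_of_mem_erase hα
        have hs : α.succ ≠ Fin.succ 0 := fun h => hα' (Fin.succ_injective _ h)
        rw [pd_eq, dd_flux hA hu.1 α (ev_tan hs), DL_flux hA (sm_dd hu.1 _) α T hT0, DL_append]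
        rfl
      have c1 : Continuous fun q => ‖dd (ev d 0) (DL T u) q‖ ^ 2 :=
        (sm_dd (sm_DL hu.1 T) _).continuous.norm.pow 2
      have c2 : ∀ α : Fin d, Continuous fun q => ‖flux Ab (DL (T ++ [α.succ]) u) α q‖ ^ 2 :=
        fun α => (sm_flux hA (sm_DL hu.1 _) α).continuous.norm.pow 2
      have i1 : ∫ q in Qc0 3, ‖dd (ev d 0) (DL T u) q‖ ^ 2 ≤ C1 * (C3 * E) := by
        refine ((h1 Ab hC hA _ (hu.DL hA T hT0)).1).trans ?_
        gcongr
        exact h3 Ab hC hA u hu T hT0 (by omega)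
      have i2 : ∀ α ∈ Finset.univ.erase (0 : Fin d),
          ∫ q in Qc0 3, ‖flux Ab (DL (T ++ [α.succ]) u) α q‖ ^ 2 ≤ d * δ⁻¹ ^ 2 * C2 * E := by
        intro α hα
        exact key _ (sm_flux hA (sm_DL hu.1 _) α) _ (by positivity) _
          (hTa α (Finset.ne_of_mem_erase hα)) (hTal α) (norm_flux_sq_le hC _ α)
      have hcard : ((Finset.univ.erase (0 : Fin d)).card : ℝ) ≤ d := by
        have := Finset.card_erase_le (s := Finset.univ) (a := (0 : Fin d))
        rw [Finset.card_univ, Fintype.card_fin] at this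
        exact_mod_cast this
      have hb : ∀ q ∈ Qc0 (d := d) 3, ‖DL T (dd (ev d (Fin.succ 0)) (flux Ab u 0)) q‖ ^ 2
          ≤ 2 * ‖dd (ev d 0) (DL T u) q‖ ^ 2 + 2 * d * ∑ α ∈ Finset.univ.erase (0 : Fin d),
            ‖flux Ab (DL (T ++ [α.succ]) u) α q‖ ^ 2 := by
        intro q hq
        rw [hpt q (Qc0_mono (by norm_num) (by norm_num) hq)]
        set a := dd (ev d 0) (DL T u) q
        set b := fun α : Fin d => flux Ab (DL (T ++ [α.succ]) u) α q
        have t1 : ‖a - ∑ α ∈ Finset.univ.erase (0 : Fin d), b α‖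
            ≤ ‖a‖ + ∑ α ∈ Finset.univ.erase (0 : Fin d), ‖b α‖ :=
          (norm_sub_le _ _).trans (by gcongr; exact norm_sum_le _ _)
        have t2 : (∑ α ∈ Finset.univ.erase (0 : Fin d), ‖b α‖) ^ 2
            ≤ d * ∑ α ∈ Finset.univ.erase (0 : Fin d), ‖b α‖ ^ 2 := by
          refine sq_sum_le_card_mul_sum_sq.trans ?_
          gcongr
        have t3 : 0 ≤ ∑ α ∈ Finset.univ.erase (0 : Fin d), ‖b α‖ := by positivity
        calc ‖a - ∑ α ∈ Finset.univ.erase (0 : Fin d), b α‖ ^ 2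
            ≤ (‖a‖ + ∑ α ∈ Finset.univ.erase (0 : Fin d), ‖b α‖) ^ 2 := by gcongr
          _ ≤ 2 * ‖a‖ ^ 2 + 2 * (∑ α ∈ Finset.univ.erase (0 : Fin d), ‖b α‖) ^ 2 := by
              nlinarith [sq_nonneg (‖a‖ - ∑ α ∈ Finset.univ.erase (0 : Fin d), ‖b α‖)]
          _ ≤ _ := by nlinarith
      calc ∫ q in Qc0 3, ‖DL T (dd (ev d (Fin.succ 0)) (flux Ab u 0)) q‖ ^ 2
          ≤ ∫ q in Qc0 3, (2 * ‖dd (ev d 0) (DL T u) q‖ ^ 2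
            + 2 * d * ∑ α ∈ Finset.univ.erase (0 : Fin d),
            ‖flux Ab (DL (T ++ [α.succ]) u) α q‖ ^ 2) := by
            refine setIntegral_mono_on (int_on_Q ((sm_DL (sm_dd hfl _) T).continuous.norm.pow 2) 3)
              (int_on_Q ((continuous_const.mul c1).add (continuous_const.mul
                (continuous_finsetSum _ fun α _ => c2 α))) 3) (measQ 3) hb
        _ = 2 * (∫ q in Qc0 3, ‖dd (ev d 0) (DL T u) q‖ ^ 2)
            + 2 * d * ∑ α ∈ Finset.univ.erase (0 : Fin d),
              ∫ q in Qc0 3, ‖flux Ab (DL (T ++ [α.succ]) u) α q‖ ^ 2 := by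
            have j1 : IntegrableOn (fun q => 2 * ‖dd (ev d 0) (DL T u) q‖ ^ 2) (Qc0 3) :=
              int_on_Q (continuous_const.mul c1) 3
            have j2 : IntegrableOn (fun q => 2 * (d : ℝ) * ∑ α ∈ Finset.univ.erase (0 : Fin d),
                ‖flux Ab (DL (T ++ [α.succ]) u) α q‖ ^ 2) (Qc0 3) :=
              int_on_Q (continuous_const.mul (continuous_finsetSum _ fun α _ => c2 α)) 3
            rw [integral_add j1 j2, integral_const_mul,
              integral_const_mul, integral_finsetSum _ fun α _ => int_on_Q (c2 α) 3]
        _ ≤ 2 * (C1 * (C3 * E)) + 2 * d * (d * (d * δ⁻¹ ^ 2 * C2 * E)) := by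
            gcongr
            refine (Finset.sum_le_sum i2).trans ?_
            rw [Finset.sum_const, nsmul_eq_mul]
            gcongr
        _ ≤ _ := by nlinarith
    · intro α hα
      rw [pd_eq, DL_perm (sm_dd hu.1 _) hp, DL_append]
      change ∫ q in Qc0 3, ‖DL T (dd (ev d (Fin.succ 0)) (dd (ev d α.succ) u)) q‖ ^ 2 ≤ _
      have e : DL T (dd (ev d (Fin.succ 0)) (dd (ev d α.succ) u))
          = dd (ev d (Fin.succ 0)) (DL (T ++ [α.succ]) u) := by
        rw [DL_dd (sm_dd hu.1 _), DL_append]; rfl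
      rw [e]
      have := key _ (sm_dd (sm_DL hu.1 (T ++ [α.succ])) (ev d (Fin.succ 0))) 1 zero_le_one _
        (hTa α hα) (hTal α) (fun q => by rw [one_mul]; exact pd_sq_le _ _ _)
      nlinarith
  · constructor
    · rw [DL_flux hA hu.1 0 S h0]
      have := key _ (sm_flux hA (sm_DL hu.1 S) 0) _ (by positivity) S h0 (by omega)
        (norm_flux_sq_le hC _ 0)
      nlinarith
    · intro α _
      rw [pd_eq, DL_dd hu.1]
      have := key _ (sm_dd (sm_DL hu.1 S) (ev d α.succ)) 1 zero_le_one S h0 (by omega)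
        (fun q => by rw [one_mul]; exact pd_sq_le _ _ _)
      nlinarith

end

section
variable {F : Type*} [NormedAddCommGroup F] [NormedSpace ℝ F] [CompleteSpace F]

theorem sq_integral_le {φ : ℝ → ℝ} (hφ : Continuous φ) {a b : ℝ} (hab : a ≤ b) :
    (∫ s in a..b, φ s) ^ 2 ≤ (b - a) * ∫ s in a..b, φ s ^ 2 := by
  rcases hab.eq_or_lt with rfl | h
  · simp
  set J := ∫ s in a..b, φ s with hJ
  set K := ∫ s in a..b, φ s ^ 2 with hK
  have hL : 0 < b - a := by linarith
  set c := J / (b - a) with hc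
  have h0 : 0 ≤ ∫ s in a..b, (φ s - c) ^ 2 :=
    intervalIntegral.integral_nonneg hab fun s _ => sq_nonneg _
  have h1 : ∫ s in a..b, (φ s - c) ^ 2 = K - 2 * c * J + c ^ 2 * (b - a) := by
    have : (fun s => (φ s - c) ^ 2) = fun s => (φ s ^ 2 - 2 * c * φ s) + c ^ 2 := by
      funext s; ring
    rw [this, intervalIntegral.integral_add, intervalIntegral.integral_sub,
      intervalIntegral.integral_const_mul, intervalIntegral.integral_const]
    · simp; ring
    all_goals exact Continuous.intervalIntegrable (by fun_prop) _ _
  have h2 : c * (b - a) = J := by rw [hc]; field_simp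
  have h3 : K - 2 * c * J + c ^ 2 * (b - a) = K - c * J := by
    have : c ^ 2 * (b - a) = c * J := by rw [← h2]; ring
    linarith
  rw [h1, h3] at h0
  calc J ^ 2 = (b - a) * (c * J) := by rw [← h2]; ring
    _ ≤ _ := by gcongr; linarith

theorem incr_sq {h h' : ℝ → F} (hd : ∀ s, HasDerivAt h (h' s) s) (hc : Continuous h')
    {a b : ℝ} (hab : a ≤ b) :
    ‖h b - h a‖ ^ 2 ≤ (b - a) * ∫ s in a..b, ‖h' s‖ ^ 2 := by
  have e : ∫ s in a..b, h' s = h b - h a :=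
    intervalIntegral.integral_eq_sub_of_hasDerivAt (fun s _ => hd s) (hc.intervalIntegrable _ _)
  rw [← e]
  calc ‖∫ s in a..b, h' s‖ ^ 2 ≤ (∫ s in a..b, ‖h' s‖) ^ 2 := by
        gcongr
        exact intervalIntegral.norm_integral_le_integral_norm hab
    _ ≤ _ := sq_integral_le hc.norm hab

theorem lint_sq {φ : ℝ → F} (hφ : Continuous φ) {a b : ℝ} (hab : a ≤ b) :
    ∫⁻ s in Icc a b, ‖φ s‖ₑ ^ 2 = ENNReal.ofReal (∫ s in a..b, ‖φ s‖ ^ 2) := by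
  rw [intervalIntegral.integral_of_le hab, ← integral_Icc_eq_integral_Ioc,
    ofReal_integral_eq_lintegral_ofReal]
  · refine lintegral_congr fun s => ?_
    rw [ENNReal.ofReal_pow (norm_nonneg _), ofReal_norm]
  · exact ((hφ.norm.pow 2).continuousOn).integrableOn_compact isCompact_Icc
  · exact Filter.Eventually.of_forall fun s => sq_nonneg _

theorem incr_lint {h h' : ℝ → F} (hd : ∀ s, HasDerivAt h (h' s) s) (hc : Continuous h')
    (a b : ℝ) :
    ‖h b - h a‖ₑ ^ 2 ≤ ENNReal.ofReal |b - a| * ∫⁻ s in uIcc a b, ‖h' s‖ₑ ^ 2 := by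
  wlog hab : a ≤ b generalizing a b
  · have := this b a (le_of_not_ge hab)
    rwa [uIcc_comm, abs_sub_comm, enorm_sub_rev] at this
  rw [uIcc_of_le hab, lint_sq hc hab, ← ENNReal.ofReal_mul (abs_nonneg _),
    ← ofReal_norm, ← ENNReal.ofReal_pow (norm_nonneg _), abs_of_nonneg (by linarith)]
  exact ENNReal.ofReal_le_ofReal (incr_sq hd hc hab)

theorem sup_lint {h h' : ℝ → F} (hd : ∀ s, HasDerivAt h (h' s) s) (hc : Continuous h')
    {c ℓ a : ℝ} (hℓ : 0 < ℓ) (hℓ1 : ℓ ≤ 1) (ha : a ∈ Icc c (c + ℓ)) :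
    ‖h a‖ₑ ^ 2 ≤ ENNReal.ofReal (2 / ℓ) *
      ∫⁻ s in Icc c (c + ℓ), (‖h s‖ₑ ^ 2 + ‖h' s‖ₑ ^ 2) := by
  have hh : Continuous h := continuous_iff_continuousAt.2 fun s => (hd s).continuousAt
  have hcl : c ≤ c + ℓ := by linarith
  have m1 : Measurable fun s => ‖h s‖ₑ ^ 2 := by
    have : Continuous fun s => ‖h s‖ₑ ^ 2 := (ENNReal.continuous_pow 2).comp hh.enorm
    exact this.measurable
  rw [lintegral_add_left m1, lint_sq hh hcl, lint_sq hc hcl,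
    ← ENNReal.ofReal_add, ← ENNReal.ofReal_mul (by positivity), ← ofReal_norm,
    ← ENNReal.ofReal_pow (norm_nonneg _)]
  rotate_left
  · exact intervalIntegral.integral_nonneg hcl fun s _ => sq_nonneg _
  · exact intervalIntegral.integral_nonneg hcl fun s _ => sq_nonneg _
  apply ENNReal.ofReal_le_ofReal
  set K := ∫ s in c..c + ℓ, ‖h' s‖ ^ 2 with hK
  have hK0 : 0 ≤ K := intervalIntegral.integral_nonneg hcl fun s _ => sq_nonneg _
  have ii : ∀ x y : ℝ, IntervalIntegrable (fun s => ‖h' s‖ ^ 2) volume x y :=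
    fun x y => (hc.norm.pow 2).intervalIntegrable _ _
  have sub : ∀ x y : ℝ, c ≤ x → x ≤ y → y ≤ c + ℓ → ‖h y - h x‖ ^ 2 ≤ ℓ * K := by
    intro x y hx hxy hy
    refine (incr_sq hd hc hxy).trans ?_
    have : ∫ s in x..y, ‖h' s‖ ^ 2 ≤ K :=
      intervalIntegral.integral_mono_interval hx hxy hy
        (Filter.Eventually.of_forall fun s => sq_nonneg _) (ii _ _)
    have h2 : 0 ≤ ∫ s in x..y, ‖h' s‖ ^ 2 :=
      intervalIntegral.integral_nonneg hxy fun s _ => sq_nonneg _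
    gcongr
    linarith
  have pw : ∀ s ∈ Icc c (c + ℓ), ‖h a‖ ^ 2 ≤ 2 * ‖h s‖ ^ 2 + 2 * (ℓ * K) := by
    intro s hs
    have t : ‖h a - h s‖ ^ 2 ≤ ℓ * K := by
      rcases le_total s a with h1 | h1
      · exact sub s a hs.1 h1 ha.2
      · rw [norm_sub_rev]; exact sub a s ha.1 h1 hs.2
    have t1 : ‖h a‖ ≤ ‖h s‖ + ‖h a - h s‖ := by
      have := norm_add_le (h s) (h a - h s)
      simpa using this
    have : ‖h a‖ ^ 2 ≤ (‖h s‖ + ‖h a - h s‖) ^ 2 := by gcongr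
    nlinarith [sq_nonneg (‖h s‖ - ‖h a - h s‖)]
  have int : ∫ s in c..c + ℓ, ‖h a‖ ^ 2 ≤ ∫ s in c..c + ℓ, (2 * ‖h s‖ ^ 2 + 2 * (ℓ * K)) :=
    intervalIntegral.integral_mono_on hcl (by simp)
      (Continuous.intervalIntegrable (by fun_prop) _ _) pw
  rw [intervalIntegral.integral_const, intervalIntegral.integral_add
    (Continuous.intervalIntegrable (by fun_prop) _ _) (by simp),
    intervalIntegral.integral_const_mul, intervalIntegral.integral_const] at int
  simp only [add_sub_cancel_left, smul_eq_mul] at int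
  have hn : 0 ≤ ∫ s in c..c + ℓ, ‖h s‖ ^ 2 :=
    intervalIntegral.integral_nonneg hcl fun s _ => sq_nonneg _
  rw [div_mul_eq_mul_div, le_div_iff₀ hℓ]
  have : ℓ * (ℓ * K) ≤ K := by
    have : ℓ * ℓ ≤ 1 := by nlinarith
    nlinarith
  linarith

end

section
variable {ι : Type*} [Fintype ι] [DecidableEq ι]
variable {F : Type*} [NormedAddCommGroup F] [NormedSpace ℝ F]

/-- Iterated sum of squared mixed derivatives. -/
def NN : List ι → ((ι → ℝ) → F) → (ι → ℝ) → ℝ≥0∞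
  | [], g => fun y => ‖g y‖ₑ ^ 2
  | i :: l, g => fun y => NN l g y + NN l (dd (Pi.single i 1) g) y

/-- Iterated coordinate derivatives. -/
def DY (L : List ι) (g : (ι → ℝ) → F) : (ι → ℝ) → F :=
  L.foldr (fun i g => dd (Pi.single i 1) g) g

theorem meas_esq {X : Type*} [TopologicalSpace X] [MeasurableSpace X] [OpensMeasurableSpace X]
    {g : X → F} (hg : Continuous g) : Measurable fun y => ‖g y‖ₑ ^ 2 :=
  ((ENNReal.continuous_pow 2).comp hg.enorm).measurable

theorem meas_NN (l : List ι) : ∀ {g : (ι → ℝ) → F}, Sm g → Measurable (NN l g) := by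
  induction l with
  | nil => intro g hg; exact meas_esq hg.continuous
  | cons i l ih => intro g hg; exact (ih hg).add (ih (sm_dd hg _))

theorem lint_NN (l : List ι) (μ : Measure (ι → ℝ)) (B : ℝ≥0∞) :
    ∀ {g : (ι → ℝ) → F}, Sm g → l.Nodup →
    (∀ S : List ι, S.Nodup → S ⊆ l → ∫⁻ y, ‖DY S g y‖ₑ ^ 2 ∂μ ≤ B) →
    ∫⁻ y, NN l g y ∂μ ≤ 2 ^ l.length * B := by
  induction l with
  | nil =>
    intro g hg _ h
    simpa [NN, DY] using h [] List.nodup_nil (List.nil_subset _)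
  | cons i l ih =>
    intro g hg hl h
    have hi := (List.nodup_cons.1 hl).1
    have hl' := (List.nodup_cons.1 hl).2
    have e : ∫⁻ y, NN (i :: l) g y ∂μ
        = ∫⁻ y, NN l g y ∂μ + ∫⁻ y, NN l (dd (Pi.single i 1) g) y ∂μ :=
      lintegral_add_left (meas_NN l hg) _
    rw [e, List.length_cons, pow_succ, mul_assoc, mul_comm 2 B, ← mul_assoc, mul_two]
    refine add_le_add (ih hg hl' fun S hS hSl => h S hS (List.subset_cons_of_subset _ hSl))
      (ih (sm_dd hg _) hl' fun S hS hSl => ?_)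
    have : DY S (dd (Pi.single i 1) g) = DY (S ++ [i]) g := by simp [DY, List.foldr_append]
    rw [this]
    refine h _ ?_ ?_
    · rw [List.nodup_append]
      refine ⟨hS, by simp, ?_⟩
      intro a ha b hb hab
      simp only [List.mem_singleton] at hb
      exact hi (hb ▸ hab ▸ hSl ha)
    · intro a ha
      rcases List.mem_append.1 ha with ha | ha
      · exact List.mem_cons_of_mem _ (hSl ha)
      · simp only [List.mem_singleton] at ha
        simp [ha]

theorem hasDeriv_upd {g : (ι → ℝ) → F} (hg : Sm g) (y : ι → ℝ) (i : ι) (s : ℝ) :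
    HasDerivAt (fun s => g (Function.update y i s))
      (dd (Pi.single i 1) g (Function.update y i s)) s :=
  (hg.da _).hasFDerivAt.comp_hasDerivAt s (hasDerivAt_update y i s)

variable [CompleteSpace F]

theorem sup_NN {c : ι → ℝ} {ℓ : ℝ} (hℓ : 0 < ℓ) (hℓ1 : ℓ ≤ 1) (μ : ι → Measure ℝ)
    [∀ i, SigmaFinite (μ i)] (l : List ι) :
    ∀ {g : (ι → ℝ) → F}, Sm g → l.Nodup →
    (∀ i ∈ l, μ i = volume.restrict (Icc (c i) (c i + ℓ))) →
    ∀ y : ι → ℝ, (∀ i ∈ l, y i ∈ Icc (c i) (c i + ℓ)) →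
    ‖g y‖ₑ ^ 2 ≤ ENNReal.ofReal (2 / ℓ) ^ l.length * (∫⋯∫⁻_l.toFinset, NN l g ∂μ) y := by
  induction l with
  | nil => intro g hg _ _ y _; simp [NN]
  | cons i l ih =>
    intro g hg hl hμ y hy
    have hi := (List.nodup_cons.1 hl).1
    have hl' := (List.nodup_cons.1 hl).2
    have hμi := hμ i List.mem_cons_self
    have m1 := meas_NN l hg
    have m2 := meas_NN l (sm_dd hg (Pi.single i 1))
    have b := sup_lint (hasDeriv_upd hg y i)
      ((sm_dd hg _).continuous.comp (continuous_const.update i continuous_id)) hℓ hℓ1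
      (hy i List.mem_cons_self)
    rw [Function.update_eq_self] at b
    refine b.trans ?_
    rw [List.toFinset_cons, lmarginal_insert _ (meas_NN (i :: l) hg) (by simpa using hi),
      List.length_cons, pow_succ, mul_comm (_ ^ _), mul_assoc, hμi]
    gcongr
    rw [← lintegral_const_mul' _ _ (by finiteness)]
    refine lintegral_mono fun s => ?_
    have hy' : ∀ j ∈ l, Function.update y i s j ∈ Icc (c j) (c j + ℓ) := by
      intro j hj
      rw [Function.update_of_ne (fun h : j = i => hi (h ▸ hj))]
      exact hy j (List.mem_cons_of_mem _ hj)
    have a1 := ih hg hl' (fun j hj => hμ j (List.mem_cons_of_mem _ hj)) _ hy'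
    have a2 := ih (sm_dd hg (Pi.single i 1)) hl'
      (fun j hj => hμ j (List.mem_cons_of_mem _ hj)) _ hy'
    refine (add_le_add a1 a2).trans ?_
    rw [← mul_add]
    gcongr
    simp only [lmarginal]
    rw [← lintegral_add_left]
    · rfl
    · exact m1.comp measurable_updateFinset

theorem incr_NN {c : ι → ℝ} {ℓ : ℝ} (hℓ : 0 < ℓ) (hℓ1 : ℓ ≤ 1) {g : (ι → ℝ) → F} (hg : Sm g)
    (y : ι → ℝ) (i : ι) (s : ℝ) (hy : ∀ j, j ≠ i → y j ∈ Icc (c j) (c j + ℓ))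
    (B : ℝ≥0∞)
    (hB : ∀ S : List ι, S.Nodup → ∫⁻ z in Set.univ.pi (fun j => if j = i then uIcc (y i) s
      else Icc (c j) (c j + ℓ)), ‖DY S g z‖ₑ ^ 2 ≤ B) :
    ‖g (Function.update y i s) - g y‖ₑ ^ 2 ≤
      ENNReal.ofReal |s - y i| * (ENNReal.ofReal (4 / ℓ) ^ (Fintype.card ι) * B) := by
  set l := (Finset.univ.erase i).toList with hl
  set I : ι → Set ℝ := fun j => if j = i then uIcc (y i) s else Icc (c j) (c j + ℓ) with hI
  set μ : ι → Measure ℝ := fun j => volume.restrict (I j) with hμ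
  have hnd : l.Nodup := Finset.nodup_toList _
  have hil : i ∉ l := by simp [hl]
  have hmem : ∀ j ∈ l, j ≠ i := by intro j hj h; exact hil (h ▸ hj)
  have hlt : l.toFinset = Finset.univ.erase i := Finset.toList_toFinset _
  have hlen : l.length ≤ Fintype.card ι := by
    rw [hl, Finset.length_toList]; exact Finset.card_le_univ _
  have b := incr_lint (hasDeriv_upd hg y i)
      ((sm_dd hg _).continuous.comp (continuous_const.update i continuous_id)) (y i) s
  rw [Function.update_eq_self] at b
  refine b.trans ?_
  gcongr
  have hdg := sm_dd hg (Pi.single i 1)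
  have s1 : ∫⁻ r in uIcc (y i) s, ‖dd (Pi.single i 1) g (Function.update y i r)‖ₑ ^ 2
      ≤ ENNReal.ofReal (2 / ℓ) ^ l.length *
        ∫⁻ z in Set.univ.pi I, NN l (dd (Pi.single i 1) g) z := by
    have e : ∫⁻ z in Set.univ.pi I, NN l (dd (Pi.single i 1) g) z
        = ∫⁻ r in uIcc (y i) s, (∫⋯∫⁻_l.toFinset, NN l (dd (Pi.single i 1) g) ∂μ)
            (Function.update y i r) := by
      have e1 : (volume : Measure (ι → ℝ)).restrict (Set.univ.pi I) = Measure.pi μ := by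
        rw [volume_pi, Measure.restrict_pi_pi]
      rw [e1, lintegral_eq_lmarginal_univ y, ← Finset.insert_erase (Finset.mem_univ i), ← hlt,
        lmarginal_insert _ (meas_NN l hdg) (by simpa using hil)]
      simp [hμ, hI]
    rw [e, ← lintegral_const_mul' _ _ (by finiteness)]
    refine lintegral_mono fun r => ?_
    refine sup_NN (c := c) hℓ hℓ1 μ l hdg hnd ?_ _ ?_
    · intro j hj; simp [hμ, hI, hmem j hj]
    · intro j hj
      rw [Function.update_of_ne (hmem j hj)]
      exact hy j (hmem j hj)
  have s2 := lint_NN l (volume.restrict (Set.univ.pi I)) B hdg hnd (by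
    intro S hS hSl
    have : DY S (dd (Pi.single i 1) g) = DY (S ++ [i]) g := by simp [DY, List.foldr_append]
    rw [this]
    refine hB _ ?_
    rw [List.nodup_append]
    refine ⟨hS, by simp, ?_⟩
    intro a ha b hb hab
    simp only [List.mem_singleton] at hb
    exact hil (hb ▸ hab ▸ hSl ha))
  calc _ ≤ _ := s1
    _ ≤ ENNReal.ofReal (2 / ℓ) ^ l.length * (2 ^ l.length * B) := by gcongr
    _ = ENNReal.ofReal (4 / ℓ) ^ l.length * B := by
        rw [← mul_assoc, ← mul_pow]
        congr 2
        rw [show (2 : ℝ≥0∞) = ENNReal.ofReal 2 by simp, ← ENNReal.ofReal_mul (by positivity)]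
        congr 1; ring
    _ ≤ _ := by
        gcongr
        rw [ENNReal.one_le_ofReal, le_div_iff₀ hℓ]; linarith

end

section
variable {d m : ℕ} [NeZero d]

/-- Coordinates on `ℝ^{1+d}`. -/
def Phi (d : ℕ) : (Fin (d + 1) → ℝ) →L[ℝ] ℝ × Ed d :=
  (ContinuousLinearMap.proj (R := ℝ) (φ := fun _ : Fin (d + 1) => ℝ) 0).prod
    (((EuclideanSpace.equiv (Fin d) ℝ).symm : (Fin d → ℝ) →L[ℝ] Ed d).comp
      (ContinuousLinearMap.pi fun j : Fin d =>
        ContinuousLinearMap.proj (R := ℝ) (φ := fun _ : Fin (d + 1) => ℝ) j.succ))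

theorem Phi_fst (y : Fin (d + 1) → ℝ) : (Phi d y).1 = y 0 := rfl
theorem Phi_snd (y : Fin (d + 1) → ℝ) (j : Fin d) : (Phi d y).2 j = y j.succ := rfl

theorem Phi_cons (p : ℝ × Ed d) : Phi d (Fin.cons p.1 (fun j => p.2 j)) = p := by
  refine Prod.ext rfl ?_
  ext j
  rw [Phi_snd]; simp

theorem Phi_single (i : Fin (d + 1)) : Phi d (Pi.single i 1) = ev d i := by
  refine Fin.cases ?_ (fun α => ?_) i
  · refine Prod.ext ?_ ?_
    · simp [Phi_fst, ev]
    · ext j; rw [Phi_snd]; simp [ev]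
  · refine Prod.ext ?_ ?_
    · simp [Phi_fst, ev]
    · ext j; rw [Phi_snd]
      simp [ev, Pi.single_apply, Fin.succ_inj]

theorem Phi_mp : MeasurePreserving (Phi d) volume volume := by
  have h1 := volume_preserving_piFinSuccAbove (fun _ : Fin (d + 1) => ℝ) 0
  have h2 := (MeasurePreserving.id (volume : Measure ℝ)).prod
    (PiLp.volume_preserving_toLp (Fin d))
  exact h2.comp h1

theorem DY_comp {f : ℝ × Ed d → Em m} (hf : Sm f) (S : List (Fin (d + 1))) :
    DY S (f ∘ Phi d) = DL S f ∘ Phi d := by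
  induction S with
  | nil => rfl
  | cons i S ih =>
    have : DY (i :: S) (f ∘ Phi d) = dd (Pi.single i 1) (DY S (f ∘ Phi d)) := rfl
    rw [this, ih]
    funext y
    have h : HasFDerivAt (DL S f ∘ Phi d) ((fderiv ℝ (DL S f) (Phi d y)).comp (Phi d)) y :=
      ((sm_DL hf S).da _).hasFDerivAt.comp y (Phi d).hasFDerivAt
    rw [dd, h.fderiv, ContinuousLinearMap.comp_apply, Phi_single]
    rfl

theorem box_sub {p q y z : Fin (d + 1) → ℝ} {ℓ : ℝ} (hℓ : ℓ = 1 / ((d : ℝ) + 1))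
    (hp : Phi d p ∈ Qc0 (d := d) 1) (hq : Phi d q ∈ Qc0 (d := d) 1)
    (hy : ∀ j, y j = p j ∨ y j = q j) (i : Fin (d + 1))
    (hz : z ∈ Set.univ.pi (fun j => if j = i then uIcc (y i) (q i)
      else Icc ((if j = 0 then y 0 - ℓ else y j)) ((if j = 0 then y 0 - ℓ else y j) + ℓ))) :
    Phi d z ∈ Qc0 (d := d) 3 := by
  have hd : (0 : ℝ) < d := by exact_mod_cast Nat.pos_of_ne_zero (NeZero.ne d)
  have hℓ0 : 0 < ℓ := by rw [hℓ]; positivity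
  have hdl : d * ℓ ≤ 1 := by rw [hℓ, mul_one_div, div_le_one (by positivity)]; linarith
  have hℓ1 : ℓ ≤ 1 := by rw [hℓ, div_le_one (by positivity)]; linarith
  have ball_iff : ∀ (w : Fin (d + 1) → ℝ) (r : ℝ), 0 < r →
      (Phi d w ∈ Qc0 (d := d) r ↔ (-r ^ 2 < w 0 ∧ w 0 < 0) ∧ ∑ j : Fin d, w j.succ ^ 2 < r ^ 2) := by
    intro w r hr
    have hn : ‖(Phi d w).2‖ < r ↔ ∑ j : Fin d, w j.succ ^ 2 < r ^ 2 := by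
      rw [EuclideanSpace.norm_eq, Real.sqrt_lt' hr]
      simp [Phi_snd]
    unfold Qc0 Qc
    rw [Set.mem_prod, mem_ball_zero_iff, hn, Phi_fst, mem_Ioo, zero_sub]
  rw [ball_iff _ _ (by norm_num)] at hp hq ⊢
  have hz' := fun j => hz j (Set.mem_univ j)
  have hyi : y 0 ∈ Ioo (-1 : ℝ) 0 := by
    rcases hy 0 with h | h <;> rw [h] <;> constructor <;> linarith [hp.1.1, hp.1.2, hq.1.1, hq.1.2]
  refine ⟨?_, ?_⟩
  · have h := hz' 0
    by_cases h0 : (0 : Fin (d + 1)) = i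
    · subst h0
      simp only [if_true] at h
      have hb : uIcc (y 0) (q 0) ⊆ Ioo (-1 : ℝ) 0 :=
        Set.OrdConnected.uIcc_subset ordConnected_Ioo hyi
          ⟨by linarith [hq.1.1], hq.1.2⟩
      have := hb h
      exact ⟨by linarith [this.1], this.2⟩
    · simp only [if_neg h0, if_true] at h
      exact ⟨by linarith [h.1, hyi.1], by linarith [h.2, hyi.2]⟩
  · have key : ∀ j : Fin d, z j.succ ^ 2 ≤ 2 * (p j.succ ^ 2 + q j.succ ^ 2) + 2 * ℓ * ℓ := by
      intro j
      have h := hz' j.succ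
      beta_reduce at h
      have hy2 : y j.succ ^ 2 ≤ p j.succ ^ 2 + q j.succ ^ 2 := by
        rcases hy j.succ with h | h <;> rw [h] <;> nlinarith [sq_nonneg (p j.succ), sq_nonneg (q j.succ)]
      by_cases h0 : j.succ = i
      · rw [if_pos h0] at h
        rw [← h0] at h
        have : z j.succ ^ 2 ≤ y j.succ ^ 2 + q j.succ ^ 2 := by
          rcases Set.mem_uIcc.1 h with h | h
          · rcases le_total 0 (z j.succ) with h3 | h3
            · nlinarith [sq_nonneg (y j.succ)]
            · nlinarith [sq_nonneg (q j.succ)]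
          · rcases le_total 0 (z j.succ) with h3 | h3
            · nlinarith [sq_nonneg (q j.succ)]
            · nlinarith [sq_nonneg (y j.succ)]
        nlinarith [sq_nonneg (p j.succ), mul_pos hℓ0 hℓ0]
      · rw [if_neg h0, if_neg (Fin.succ_ne_zero j)] at h
        have h1 : 0 ≤ z j.succ - y j.succ := by linarith [h.1]
        have h2 : z j.succ - y j.succ ≤ ℓ := by linarith [h.2]
        nlinarith [sq_nonneg (z j.succ - 2 * y j.succ)]
    calc ∑ j : Fin d, z j.succ ^ 2
        ≤ ∑ j : Fin d, (2 * (p j.succ ^ 2 + q j.succ ^ 2) + 2 * ℓ * ℓ) :=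
          Finset.sum_le_sum fun j _ => key j
      _ = 2 * (∑ j : Fin d, p j.succ ^ 2 + ∑ j : Fin d, q j.succ ^ 2) + d * (2 * ℓ * ℓ) := by
          rw [Finset.sum_add_distrib, ← Finset.mul_sum, Finset.sum_add_distrib]; simp
      _ < 3 ^ 2 := by nlinarith [hp.2, hq.2]

theorem holder {f : ℝ × Ed d → Em m} (hf : Sm f) {B : ℝ} (hB0 : 0 ≤ B)
    (hB : ∀ S : List (Fin (d + 1)), S.Nodup → ∫ q in Qc0 3, ‖DL S f q‖ ^ 2 ≤ B)
    (p q : ℝ × Ed d) (hp : p ∈ Qc0 (d := d) 1) (hq : q ∈ Qc0 (d := d) 1) :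
    ‖f p - f q‖ ≤ ((d : ℝ) + 1) * Real.sqrt ((4 * ((d : ℝ) + 1)) ^ (d + 1) * B)
      * (|p.1 - q.1| ^ ((1:ℝ)/4) + ‖p.2 - q.2‖ ^ ((1:ℝ)/2)) := by
  set K : ℝ := (4 * ((d : ℝ) + 1)) ^ (d + 1) * B with hK
  have hK0 : 0 ≤ K := by positivity
  set P : Fin (d + 1) → ℝ := Fin.cons p.1 (fun j => p.2 j) with hP
  set Q : Fin (d + 1) → ℝ := Fin.cons q.1 (fun j => q.2 j) with hQ
  have hPp : Phi d P = p := Phi_cons p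
  have hQq : Phi d Q = q := Phi_cons q
  set ℓ : ℝ := 1 / ((d : ℝ) + 1) with hℓ
  have hd : (0 : ℝ) < d := by exact_mod_cast Nat.pos_of_ne_zero (NeZero.ne d)
  have hℓ0 : 0 < ℓ := by rw [hℓ]; positivity
  have hℓ1 : ℓ ≤ 1 := by rw [hℓ, div_le_one (by positivity)]; linarith
  have hg : Sm (f ∘ Phi d) := hf.comp (Phi d).contDiff
  have one : ∀ (y : Fin (d + 1) → ℝ) (i : Fin (d + 1)), (∀ j, y j = P j ∨ y j = Q j) →
      ‖f (Phi d (Function.update y i (Q i))) - f (Phi d y)‖ ≤ Real.sqrt (|Q i - y i| * K) := by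
    intro y i hy
    have := incr_NN (c := fun j => if j = 0 then y 0 - ℓ else y j) hℓ0 hℓ1 hg y i (Q i) (by
      intro j _
      by_cases h : j = 0
      · subst h; simp [hℓ0.le]
      · simp [h, hℓ0.le]) (ENNReal.ofReal B) (by
      intro S hS
      rw [DY_comp hf S]
      calc _ ≤ ∫⁻ z in (Phi d) ⁻¹' (Qc0 3), ‖DL S f (Phi d z)‖ₑ ^ 2 := by
            refine lintegral_mono_set fun z hz => ?_
            exact box_sub hℓ (hPp.symm ▸ hp) (hQq.symm ▸ hq) hy i hz
        _ = ∫⁻ z in Qc0 3, ‖DL S f z‖ₑ ^ 2 :=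
            Phi_mp.setLIntegral_comp_preimage (measQ 3) (meas_esq (sm_DL hf S).continuous)
        _ = ENNReal.ofReal (∫ z in Qc0 3, ‖DL S f z‖ ^ 2) := by
            rw [ofReal_integral_eq_lintegral_ofReal]
            · refine lintegral_congr fun s => ?_
              rw [ENNReal.ofReal_pow (norm_nonneg _), ofReal_norm]
            · exact int_on_Q ((sm_DL hf S).continuous.norm.pow 2) 3
            · exact Filter.Eventually.of_forall fun s => sq_nonneg _
        _ ≤ _ := ENNReal.ofReal_le_ofReal (hB S hS))
    rw [← ENNReal.ofReal_pow (by positivity), ← ENNReal.ofReal_mul (by positivity),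
      ← ENNReal.ofReal_mul (abs_nonneg _), ← ofReal_norm,
      ← ENNReal.ofReal_pow (norm_nonneg _), ENNReal.ofReal_le_ofReal_iff (by positivity),
      Fintype.card_fin] at this
    refine Real.le_sqrt_of_sq_le (this.trans (le_of_eq ?_))
    rw [hK, hℓ]
    congr 3
    field_simp
  have path : ∀ s : Finset (Fin (d + 1)),
      ‖f (Phi d (s.piecewise Q P)) - f (Phi d P)‖ ≤ ∑ i ∈ s, Real.sqrt (|Q i - P i| * K) := by
    intro s
    induction s using Finset.induction_on with
    | empty => simp
    | insert i s hi ih =>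
      have h := one (s.piecewise Q P) i (fun j => by
        by_cases hj : j ∈ s
        · right; simp [hj]
        · left; simp [hj])
      rw [← Finset.piecewise_insert, Finset.piecewise_eq_of_notMem _ _ _ hi] at h
      rw [Finset.sum_insert hi]
      calc _ ≤ ‖f (Phi d ((insert i s).piecewise Q P)) - f (Phi d (s.piecewise Q P))‖
          + ‖f (Phi d (s.piecewise Q P)) - f (Phi d P)‖ := norm_sub_le_norm_sub_add_norm_sub _ _ _
        _ ≤ _ := add_le_add h ih
  have h := path Finset.univ
  rw [Finset.piecewise_univ, hPp, hQq, norm_sub_rev] at h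
  set D : ℝ := |p.1 - q.1| ^ ((1:ℝ)/4) + ‖p.2 - q.2‖ ^ ((1:ℝ)/2) with hD
  have each : ∀ i ∈ Finset.univ, Real.sqrt (|Q i - P i| * K) ≤ D * Real.sqrt K := by
    intro i _
    rw [Real.sqrt_mul (abs_nonneg _)]
    gcongr
    rw [Real.sqrt_eq_rpow]
    refine Fin.cases ?_ (fun j => ?_) i
    · have e : |Q 0 - P 0| = |p.1 - q.1| := by rw [abs_sub_comm]; rfl
      have h1 : |p.1 - q.1| ≤ 1 := by
        have a := hp.1; have b := hq.1
        simp only [mem_Ioo] at a b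
        rw [abs_le]; constructor <;> linarith [a.1, a.2, b.1, b.2]
      rw [e, hD]
      have := Real.rpow_le_rpow_of_exponent_ge' (abs_nonneg (p.1 - q.1)) h1
        (z := 1 / 4) (y := 1 / 2) (by norm_num) (by norm_num)
      have h2 : 0 ≤ ‖p.2 - q.2‖ ^ ((1:ℝ)/2) := by positivity
      linarith
    · have e : |Q j.succ - P j.succ| = |p.2 j - q.2 j| := by rw [abs_sub_comm]; rfl
      have h1 : |p.2 j - q.2 j| ≤ ‖p.2 - q.2‖ := by
        have := PiLp.norm_apply_le (p.2 - q.2) j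
        simpa using this
      rw [e, hD]
      have := Real.rpow_le_rpow (abs_nonneg _) h1 (z := 1 / 2) (by norm_num)
      have h2 : 0 ≤ |p.1 - q.1| ^ ((1:ℝ)/4) := by positivity
      linarith
  calc ‖f p - f q‖ ≤ _ := h
    _ ≤ ∑ i : Fin (d + 1), D * Real.sqrt K := Finset.sum_le_sum each
    _ = _ := by simp; ring

end

/-- Parabolic Hölder `C^{1/2}` estimates: for homogeneous systems
with smooth coefficients depending only on `x₁`, with `U = Σ_β Ā^{1β}(x₁) D_βu`,
`[U]_{C^{1/2}(Q₁)} ≤ N‖Du‖_{L₂(Q₄)}` and `[D_αu]_{C^{1/2}(Q₁)} ≤ N‖Du‖_{L₂(Q₄)}`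
for every `α = 2,…,d`, with `N = N(d,m,δ)` independent of any smoothness norms
of `Ā`. -/
theorem stmt_10
    (d m : ℕ) [NeZero d] [NeZero m] (δ : ℝ) (hδ : δ ∈ Set.Ioc (0:ℝ) 1) :
    ∃ N : ℝ, 0 < N ∧
    ∀ (Ab : Fin d → Fin d → ℝ → CLM m), CoeffsOne δ Ab →
      (∀ α β, ContDiff ℝ (⊤ : ℕ∞) (Ab α β)) →
    ∀ u : ℝ × Ed d → Em m, ContDiff ℝ (⊤ : ℕ∞) u →
    -- `-u_t + D_α(Ā^{αβ}(x₁)D_βu) = 0` weakly in `Q₄`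
    (∀ φt : ℝ × Ed d → Em m, ContDiff ℝ (⊤ : ℕ∞) φt → HasCompactSupport φt →
      tsupport φt ⊆ Qc0 4 →
      ∫ q, (⟪u q, pt φt q⟫ - ∑ α, ∑ β, ⟪Ab α β (q.2 0) (pd β u q), pd α φt q⟫) = 0) →
    ∀ p q : ℝ × Ed d, p ∈ Qc0 (d := d) 1 → q ∈ Qc0 (d := d) 1 →
      (‖Ubar Ab u p - Ubar Ab u q‖
          ≤ N * (|p.1 - q.1| ^ ((1:ℝ)/4) + ‖p.2 - q.2‖ ^ ((1:ℝ)/2))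
            * Real.sqrt (∫ q' in Qc0 (d := d) 4, gradSq u q')) ∧
      ∀ α : Fin d, α ≠ 0 →
        ‖pd α u p - pd α u q‖
          ≤ N * (|p.1 - q.1| ^ ((1:ℝ)/4) + ‖p.2 - q.2‖ ^ ((1:ℝ)/2))
            * Real.sqrt (∫ q' in Qc0 (d := d) 4, gradSq u q') := by
  obtain ⟨C, hC, hmix⟩ := mixed (d := d) (m := m) hδ.1
  refine ⟨((d : ℝ) + 1) * Real.sqrt ((4 * ((d : ℝ) + 1)) ^ (d + 1) * C), by positivity, ?_⟩
  intro Ab hAb hA u hu hw p q hp hq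
  have hs : Sol Ab u := sol_of_weak hA hu hw
  have hM := hmix Ab hAb hA u hs
  have hE0 : 0 ≤ ∫ q' in Qc0 (d := d) 4, gradSq u q' := integral_nonneg fun q => gradSq_nonneg u q
  have fin : ∀ f : ℝ × Ed d → Em m, Sm f →
      (∀ S : List (Fin (d + 1)), S.Nodup →
        ∫ q in Qc0 3, ‖DL S f q‖ ^ 2 ≤ C * ∫ q' in Qc0 (d := d) 4, gradSq u q') →
      ‖f p - f q‖ ≤ ((d : ℝ) + 1) * Real.sqrt ((4 * ((d : ℝ) + 1)) ^ (d + 1) * C)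
        * (|p.1 - q.1| ^ ((1:ℝ)/4) + ‖p.2 - q.2‖ ^ ((1:ℝ)/2))
        * Real.sqrt (∫ q' in Qc0 (d := d) 4, gradSq u q') := by
    intro f hf h
    have := holder hf (mul_nonneg hC.le hE0) h p q hp hq
    rw [← mul_assoc, Real.sqrt_mul (by positivity)] at this
    refine this.trans (le_of_eq (by ring))
  refine ⟨fin (flux Ab u 0) (sm_flux hA hu 0) fun S hS => (hM S hS).1, fun α hα => ?_⟩
  exact fin (pd α u) (sm_dd hu (ev d α.succ)) fun S hS => (hM S hS).2 α hα
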